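/- Let p ≥ 5 be a prime and G a finite nonabelian simple group. If P is a Sylow p-subgroup of G with P ≠ 1, then P < N_G(P). -/

import Mathlib

open Subgroup

set_option linter.unusedSectionVars false

namespace SNT
set_option linter.unusedSimpArgs false

/-- the commutator `x y x⁻¹ y⁻¹`, as a function of `y`. -/
def ad {G : Type*} [Group G] (x y : G) : G := x * y * x⁻¹ * y⁻¹

lemma ad_one {G : Type*} [Group G] (x : G) : ad x 1 = 1 := by simp [ad]

lemma ad_eq_one {G : Type*} [Group G] {x y : G} : ad x y = 1 ↔ x * y = y * x := by
  rw [ad, mul_inv_eq_one, mul_inv_eq_iff_eq_mul]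

lemma map_ad {G G' : Type*} [Group G] [Group G'] (f : G →* G') (x y : G) :
    f (ad x y) = ad (f x) (f y) := by simp [ad]

/-- `M` is an abelian subgroup of `P` normalised by `R`. -/
def CondO {G : Type*} [Group G] (P R M : Subgroup G) : Prop :=
  M ≤ P ∧ (∀ a ∈ M, ∀ b ∈ M, a * b = b * a) ∧ (∀ r ∈ R, ∀ m ∈ M, r * m * r⁻¹ ∈ M)

/-- the class two subgroups acting quadratically on abelian subgroups of `R`. -/
def CondE {G : Type*} [Group G] (P R M : Subgroup G) : Prop :=
  M ≤ P ∧ (∀ r ∈ R, ∀ m ∈ M, r * m * r⁻¹ ∈ M) ∧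
  (∀ a ∈ M, ∀ b ∈ M, ∀ c ∈ M, ad a (ad b c) = 1) ∧
  ∀ N : Subgroup G, N ≤ R → (∀ a ∈ N, ∀ b ∈ N, a * b = b * a) →
    (∀ m ∈ M, ∀ n ∈ N, m * n * m⁻¹ ∈ N) →
    ∀ a ∈ M, ∀ b ∈ M, ∀ n ∈ N, ad a (ad b n) = 1

def OO {G : Type*} [Group G] (P R : Subgroup G) : Subgroup G := sSup {M | CondO P R M}
def EE {G : Type*} [Group G] (P R : Subgroup G) : Subgroup G := sSup {M | CondE P R M}
def WW {G : Type*} [Group G] (P : Subgroup G) : Subgroup G :=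
  sInf {R | R ≤ P ∧ EE P (OO P R) ≤ R}

section basic
variable {G : Type*} [Group G]

lemma OO_le (P R : Subgroup G) : OO P R ≤ P := sSup_le fun _ h => h.1
lemma EE_le (P R : Subgroup G) : EE P R ≤ P := sSup_le fun _ h => h.1

lemma OO_anti (P : Subgroup G) {R S : Subgroup G} (h : R ≤ S) : OO P S ≤ OO P R :=
  sSup_le_sSup fun _ hM => ⟨hM.1, hM.2.1, fun r hr => hM.2.2 r (h hr)⟩

lemma EE_anti (P : Subgroup G) {R S : Subgroup G} (h : R ≤ S) : EE P S ≤ EE P R :=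
  sSup_le_sSup fun _ hM => ⟨hM.1, fun r hr => hM.2.1 r (h hr), hM.2.2.1,
    fun N hN => hM.2.2.2 N (hN.trans h)⟩

lemma WW_le (P : Subgroup G) : WW P ≤ P := sInf_le ⟨le_rfl, EE_le _ _⟩

lemma WW_pre (P : Subgroup G) : EE P (OO P (WW P)) ≤ WW P := by
  refine le_sInf fun R hR => le_trans ?_ hR.2
  exact EE_anti P (OO_anti P (sInf_le hR))

lemma WW_min (P R : Subgroup G) (h : R ≤ P) (h2 : EE P (OO P R) ≤ R) : WW P ≤ R :=
  sInf_le ⟨h, h2⟩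

lemma EE_le_WW (P : Subgroup G) : EE P P ≤ WW P :=
  (EE_anti P (OO_le _ _)).trans (WW_pre P)

lemma center_le_WW (P : Subgroup G) (z : G) (hz : z ∈ P) (hc : ∀ u ∈ P, u * z = z * u) :
    z ∈ WW P := by
  apply EE_le_WW
  have : CondE P P (P ⊓ centralizer (P : Set G)) := by
    refine ⟨inf_le_left, ?_, ?_, ?_⟩
    · rintro r hr m ⟨hm, hm2⟩
      have := mem_centralizer_iff.1 hm2 r hr
      rw [this]; simpa using ⟨hm, hm2⟩
    · rintro a ⟨ha, ha2⟩ b ⟨hb, hb2⟩ c ⟨hc, hc2⟩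
      have := mem_centralizer_iff.1 hb2 c hc
      have h1 : ad b c = 1 := ad_eq_one.2 this.symm
      rw [h1, ad_one]
    · rintro N hN _ _ a ⟨ha, ha2⟩ b ⟨hb, hb2⟩ c hc
      have := mem_centralizer_iff.1 hb2 c (hN hc)
      have h1 : ad b c = 1 := ad_eq_one.2 this.symm
      rw [h1, ad_one]
  exact (le_sSup (a := P ⊓ centralizer (P : Set G)) this : _) ⟨hz, mem_centralizer_iff.2 hc⟩

lemma WW_ne_bot [Finite G] {p : ℕ} [Fact p.Prime] (P : Subgroup G) (hP : IsPGroup p P)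
    (hne : P ≠ ⊥) : WW P ≠ ⊥ := by
  have : Nontrivial P := (nontrivial_iff_ne_bot P).2 hne
  have := hP.center_nontrivial
  obtain ⟨⟨z, hz⟩, hz1⟩ := exists_ne (1 : center P)
  intro h
  have : (z : G) ∈ WW P := center_le_WW P z z.2 fun u hu => by
    have := mem_center_iff.1 hz ⟨u, hu⟩
    exact congrArg Subtype.val this
  rw [h, mem_bot] at this
  apply hz1
  ext
  simpa using this

end basic

section nat
variable {G G' : Type*} [Group G] [Group G'] (f : G →* G')

lemma exists_map (P : Subgroup G) (M : Subgroup G') (h : M ≤ P.map f) :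
    ∃ N, N ≤ P ∧ N.map f = M := by
  refine ⟨P ⊓ M.comap f, inf_le_left, ?_⟩
  ext m
  constructor
  · rintro ⟨x, hx, rfl⟩
    exact hx.2
  · intro hm
    obtain ⟨x, hx, rfl⟩ := h hm
    exact ⟨x, ⟨hx, hm⟩, rfl⟩


lemma condO_map (hf : Function.Injective f) (P R M : Subgroup G) : CondO (P.map f) (R.map f) (M.map f) ↔ CondO P R M := by
  unfold CondO
  rw [map_le_map_iff_of_injective hf]
  simp only [mem_map, forall_exists_index, and_imp, forall_apply_eq_imp_iff₂]
  simp only [← map_mul, ← map_inv, hf.eq_iff, exists_eq_right]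

lemma condE_map (hf : Function.Injective f) (P R M : Subgroup G) : CondE (P.map f) (R.map f) (M.map f) ↔ CondE P R M := by
  unfold CondE
  rw [map_le_map_iff_of_injective hf]
  simp only [mem_map, forall_exists_index, and_imp, forall_apply_eq_imp_iff₂]
  simp only [← map_mul, ← map_inv, hf.eq_iff, exists_eq_right, ← map_ad,
    map_eq_one_iff f hf]
  refine and_congr_right fun _ => and_congr_right fun _ => and_congr_right fun _ => ?_
  constructor
  · intro h N hN h1 h2 a ha b hb n hn
    have := h (N.map f) (map_mono hN)
    simp only [mem_map, forall_exists_index, and_imp, forall_apply_eq_imp_iff₂] at this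
    simp only [← map_mul, ← map_inv, hf.eq_iff, exists_eq_right, ← map_ad,
      map_eq_one_iff f hf] at this
    exact this h1 h2 a ha b hb n hn
  · intro h N hN
    obtain ⟨N, hN', rfl⟩ := exists_map f R N hN
    simp only [mem_map, forall_exists_index, and_imp, forall_apply_eq_imp_iff₂]
    simp only [← map_mul, ← map_inv, hf.eq_iff, exists_eq_right, ← map_ad,
      map_eq_one_iff f hf]
    exact h N hN'

lemma OO_map (hf : Function.Injective f) (P R : Subgroup G) : OO (P.map f) (R.map f) = (OO P R).map f := by
  apply le_antisymm
  · refine sSup_le fun M hM => ?_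
    obtain ⟨M, hM', rfl⟩ := exists_map f P M hM.1
    exact map_mono (le_sSup ((condO_map f hf P R M).1 hM))
  · rw [map_le_iff_le_comap]
    refine sSup_le fun M hM => ?_
    rw [← map_le_iff_le_comap]
    exact le_sSup ((condO_map f hf P R M).2 hM)

lemma EE_map (hf : Function.Injective f) (P R : Subgroup G) : EE (P.map f) (R.map f) = (EE P R).map f := by
  apply le_antisymm
  · refine sSup_le fun M hM => ?_
    obtain ⟨M, hM', rfl⟩ := exists_map f P M hM.1
    exact map_mono (le_sSup ((condE_map f hf P R M).1 hM))
  · rw [map_le_iff_le_comap]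
    refine sSup_le fun M hM => ?_
    rw [← map_le_iff_le_comap]
    exact le_sSup ((condE_map f hf P R M).2 hM)

lemma WW_map (hf : Function.Injective f) (P : Subgroup G) : WW (P.map f) = (WW P).map f := by
  apply le_antisymm
  · apply WW_min _ _ (map_mono (WW_le P))
    rw [OO_map f hf, EE_map f hf]
    exact map_mono (WW_pre P)
  · obtain ⟨R, hR, h⟩ := exists_map f P _ (WW_le (P.map f))
    rw [← h]
    apply map_mono
    apply WW_min _ _ hR
    have := WW_pre (P.map f)
    rwa [← h, OO_map f hf, EE_map f hf, map_le_map_iff_of_injective hf] at this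
end nat

lemma WW_conj {G : Type*} [Group G] (P : Subgroup G) (g : G) :
    WW (P.map (MulAut.conj g).toMonoidHom) = (WW P).map (MulAut.conj g).toMonoidHom :=
  WW_map _ (MulAut.conj g).injective P

end SNT

namespace SNT

section L1
variable {G : Type*} [Group G]

lemma ad_mem (x : G) (D : Subgroup G) [hD : D.Normal] {y : G} (hy : y ∈ D) : ad x y ∈ D :=
  D.mul_mem (hD.conj_mem y hy x) (D.inv_mem hy)

lemma ad_iter_mem (x : G) (D : Subgroup G) [hD : D.Normal] (n : ℕ) :
    ∀ {y : G}, y ∈ D → (ad x)^[n] y ∈ D := by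
  induction n with
  | zero => intro y hy; simpa using hy
  | succ n ih => intro y hy; rw [Function.iterate_succ_apply]; exact ih (ad_mem x D hy)

lemma ad_iter_one (x : G) (n : ℕ) : (ad x)^[n] 1 = 1 := Function.iterate_fixed (ad_one x) n

lemma ad_iter_mono (x : G) (D : Subgroup G) [hD : D.Normal] {m n : ℕ} (h : m ≤ n) {y : G}
    (hy : (ad x)^[m] y ∈ D) : (ad x)^[n] y ∈ D := by
  obtain ⟨k, rfl⟩ := Nat.exists_eq_add_of_le' h
  rw [Function.iterate_add_apply]
  exact ad_iter_mem x D k hy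

lemma ad_iter_mul (x : G) (V : Subgroup G) [hV : V.Normal]
    (hab : ∀ a ∈ V, ∀ b ∈ V, a * b = b * a) (n : ℕ) :
    ∀ a ∈ V, ∀ b ∈ V, (ad x)^[n] (a * b) = (ad x)^[n] a * (ad x)^[n] b := by
  induction n with
  | zero => intro a _ b _; rfl
  | succ n ih =>
    intro a ha b hb
    rw [Function.iterate_succ_apply, Function.iterate_succ_apply, Function.iterate_succ_apply,
      ← ih _ (ad_mem x V ha) _ (ad_mem x V hb)]
    congr 1
    have h := hab _ (ad_mem x V hb) _ (V.inv_mem ha)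
    calc ad x (a * b) = x * a * x⁻¹ * (ad x b * a⁻¹) := by simp only [ad]; group
      _ = _ := by rw [h]; simp only [ad]; group

lemma ad_iter_inv (x : G) (V : Subgroup G) [hV : V.Normal]
    (hab : ∀ a ∈ V, ∀ b ∈ V, a * b = b * a) (n : ℕ) (a : G) (ha : a ∈ V) :
    (ad x)^[n] a⁻¹ = ((ad x)^[n] a)⁻¹ := by
  rw [eq_inv_iff_mul_eq_one, ← ad_iter_mul x V hab n _ (V.inv_mem ha) _ ha, inv_mul_cancel,
    ad_iter_one]

lemma L1 (x : G) (U V D : Subgroup G) [hUn : U.Normal] [hVn : V.Normal] [hDn : D.Normal]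
    (hVU : V ≤ U) (hc : ∀ v ∈ V, ∀ u ∈ U, v * u = u * v) (hD : ∀ d ∈ D, ∀ v ∈ V, d * v = v * d)
    (hUD : ∀ u ∈ U, ∀ d ∈ D, ad u d ∈ V) (r s : ℕ) (hs1 : 1 ≤ s)
    (hU : ∀ u ∈ U, (ad x)^[r] u = 1) (hV : ∀ u ∈ V, (ad x)^[s] u = 1) :
    ∀ y ∈ D, ∀ u ∈ U, ad u ((ad x)^[r + s - 1] y) = 1 := by
  have b1 : ∀ u ∈ U, ∀ u' ∈ U, ∀ y ∈ D, ad (u * u') y = ad u y * ad u' y := by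
    intro u hu u' hu' y hy
    have h1 := hc _ (hUD u' hu' y hy) u hu
    have h2 := hc _ (hUD u' hu' y hy) _ (hVU (hUD u hu y hy))
    calc ad (u * u') y = u * ad u' y * u⁻¹ * ad u y := by simp only [ad]; group
      _ = _ := by rw [← h1, mul_inv_cancel_right, h2]
  have b2 : ∀ u ∈ U, ∀ y ∈ D, ∀ y' ∈ D, ad u (y * y') = ad u y * ad u y' := by
    intro u hu y hy y' hy'
    have h1 := hD y hy _ (hUD u hu y' hy')
    calc ad u (y * y') = ad u y * (y * ad u y' * y⁻¹) := by simp only [ad]; group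
      _ = _ := by rw [h1, mul_inv_cancel_right]
  have b3 : ∀ u ∈ U, ∀ y ∈ D, ad u y⁻¹ = (ad u y)⁻¹ := by
    intro u hu y hy
    rw [eq_inv_iff_mul_eq_one, ← b2 u hu _ (D.inv_mem hy) y hy, inv_mul_cancel, ad_one]
  have key : ∀ w ∈ U, ∀ y ∈ D,
      ad (x * w * x⁻¹) (ad x y) = ad x (ad w y) * (ad (ad x w) y)⁻¹ := by
    intro w hw y hy
    have e1 : ad x y = (x * y * x⁻¹) * y⁻¹ := rfl
    have e2 : ad (x * w * x⁻¹) y = ad (ad x w) y * ad w y := by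
      rw [← b1 _ (ad_mem x U hw) _ hw _ hy]; simp only [ad]; group
    rw [e1, b2 _ (hUn.conj_mem w hw x) _ (hDn.conj_mem y hy x) _ (D.inv_mem hy),
      b3 _ (hUn.conj_mem w hw x) _ hy, e2]
    simp only [ad]; group
  have hab : ∀ a ∈ V, ∀ b ∈ V, a * b = b * a := fun a ha b hb => hc a ha b (hVU hb)
  have main : ∀ n i : ℕ, ∀ u ∈ U, (ad x)^[i] u = 1 → ∀ y ∈ D, ∀ a, s + i ≤ a + n + 1 →
      (ad x)^[a] (ad u ((ad x)^[n] y)) = 1 := by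
    intro n
    induction n with
    | zero =>
      intro i u hu hi y hy a ha
      simp only [Function.iterate_zero, id]
      rcases Nat.eq_zero_or_pos i with rfl | hi0
      · simp only [Function.iterate_zero, id] at hi
        subst hi
        have : ad 1 y = 1 := by simp [ad]
        rw [this, ad_iter_one]
      · have h := ad_iter_mono x (⊥ : Subgroup G) (m := s) (n := a) (by omega)
          (y := ad u y) (by rw [hV _ (hUD u hu y hy)]; exact one_mem _)
        simpa using h
    | succ n ih =>
      intro i u hu hi y hy a ha
      have hy' := ad_iter_mem x D n hy
      rcases Nat.eq_zero_or_pos i with rfl | hi0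
      · simp only [Function.iterate_zero, id] at hi
        subst hi
        have : ad 1 ((ad x)^[n+1] y) = 1 := by simp [ad]
        rw [this, ad_iter_one]
      · obtain ⟨j, rfl⟩ : ∃ j, i = j + 1 := ⟨i - 1, by omega⟩
        have hw : x⁻¹ * u * x ∈ U := by simpa using hUn.conj_mem u hu x⁻¹
        have hadx : ∀ v, ad x (x⁻¹ * v * x) = x⁻¹ * ad x v * x := by
          intro v; simp only [ad]; group
        have hiter : ∀ m v, (ad x)^[m] (x⁻¹ * v * x) = x⁻¹ * (ad x)^[m] v * x := by
          intro m
          induction m with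
          | zero => intro v; rfl
          | succ m ihm => intro v; rw [Function.iterate_succ_apply, hadx, ihm]; rfl
        have hwi : (ad x)^[j+1] (x⁻¹ * u * x) = 1 := by rw [hiter, hi]; simp
        have hu' : u = x * (x⁻¹ * u * x) * x⁻¹ := by group
        rw [Function.iterate_succ_apply' (ad x) n y, hu', key _ hw _ hy',
          ad_iter_mul x V hab _ _ (ad_mem x V (hUD _ hw _ hy')) _
            (V.inv_mem (hUD _ (ad_mem x U hw) _ hy')),
          ad_iter_inv x V hab _ _ (hUD _ (ad_mem x U hw) _ hy'),
          ← Function.iterate_succ_apply (ad x) a, ih (j+1) _ hw hwi y hy (a+1) (by omega),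
          ih j _ (ad_mem x U hw) hwi y hy a (by omega)]
        simp
  intro y hy u hu
  exact main (r + s - 1) r u hu (hU u hu) y hy 0 (by omega)
end L1

/-- good chains of normal subgroups for the element `x`. -/
inductive Chain {G : Type*} [Group G] (p : ℕ) (x : G) : Subgroup G → Prop
  | bot : Chain p x ⊥
  | step (D D' : Subgroup G) : D.Normal → Chain p x D' → D' ≤ D →
      (∀ y ∈ D, (ad x)^[p - 1] y ∈ D') → Chain p x D

lemma Chain.normal {G : Type*} [Group G] {p : ℕ} {x : G} {D : Subgroup G} (h : Chain p x D) :
    D.Normal := by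
  cases h with
  | bot => infer_instance
  | step _ _ h => exact h

section crit
variable {G : Type*} [Group G] [Finite G] {p : ℕ} [Fact p.Prime]

lemma comm_lt (Q : Subgroup G) (hQ : IsPGroup p Q) (U : Subgroup G) (hU : U ≤ Q)
    (hne : U ≠ ⊥) : ¬ U ≤ ⁅U, Q⁆ := by
  intro hle
  have hn : Group.IsNilpotent Q := hQ.isNilpotent
  obtain ⟨n, hn⟩ := Subgroup.nilpotent_iff_lowerCentralSeries.1 hn
  have key : ∀ n, U ≤ ((⊤ : Subgroup Q).lowerCentralSeries n).map Q.subtype := by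
    intro n
    induction n with
    | zero => intro u hu; exact ⟨⟨u, hU hu⟩, by simp, rfl⟩
    | succ n ih =>
      refine hle.trans ?_
      have : (⊤ : Subgroup Q).lowerCentralSeries (n+1) = ⁅(⊤ : Subgroup Q).lowerCentralSeries n, ⊤⁆ := rfl
      rw [this, map_commutator]
      refine commutator_mono ih ?_
      intro q hq
      exact ⟨⟨q, hq⟩, by simp, rfl⟩
  have := key n
  rw [hn, Subgroup.map_bot] at this
  exact hne (le_bot_iff.1 this)

/-- a critical pair -/
structure Crit (Q T B : Subgroup G) : Prop where
  hTn : T.Normal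
  hBn : B.Normal
  hBT : B ≤ T
  hTQ : T ≤ Q
  hcent : ∀ b ∈ B, ∀ t ∈ T, b * t = t * b
  hcomm : ∀ t ∈ T, ∀ q ∈ Q, ad t q ∈ B
  hself : ∀ q ∈ Q, (∀ t ∈ T, t * q = q * t) → q ∈ B

lemma exists_crit (Q : Subgroup G) [hQn : Q.Normal] (hQ : IsPGroup p Q) :
    ∃ T B : Subgroup G, Crit Q T B := by
  obtain ⟨B, hBmax⟩ := (Set.toFinite {B : Subgroup G | B.Normal ∧ B ≤ Q ∧
    ∀ a ∈ B, ∀ b ∈ B, a * b = b * a}).exists_maximal ⟨⊥, inferInstance, bot_le, by simp⟩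
  obtain ⟨⟨hBn, hBQ, hBab⟩, hmax⟩ := hBmax
  let T : Subgroup G :=
    { carrier := {t | t ∈ Q ∧ (∀ b ∈ B, b * t = t * b) ∧ ∀ q ∈ Q, ad t q ∈ B}
      one_mem' := ⟨one_mem _, by simp, fun q _ => by simp [ad]⟩
      mul_mem' := by
        rintro s t ⟨hs1, hs2, hs3⟩ ⟨ht1, ht2, ht3⟩
        refine ⟨mul_mem hs1 ht1, fun b hb => ?_, fun q hq => ?_⟩
        · rw [← mul_assoc, hs2 b hb, mul_assoc, ht2 b hb, mul_assoc]
        · have : ad (s * t) q = s * ad t q * s⁻¹ * ad s q := by simp only [ad]; group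
          rw [this]
          exact mul_mem (hBn.conj_mem _ (ht3 q hq) s) (hs3 q hq)
      inv_mem' := by
        rintro s ⟨hs1, hs2, hs3⟩
        refine ⟨inv_mem hs1, fun b hb => ?_, fun q hq => ?_⟩
        · have := hs2 b hb
          rw [mul_inv_eq_iff_eq_mul, mul_assoc, this, inv_mul_cancel_left]
        · have : ad s⁻¹ q = s⁻¹ * (ad s q)⁻¹ * s⁻¹⁻¹ := by simp only [ad]; group
          rw [this]
          exact hBn.conj_mem _ (inv_mem (hs3 q hq)) s⁻¹ }
  have hT : ∀ t, t ∈ T ↔ t ∈ Q ∧ (∀ b ∈ B, b * t = t * b) ∧ ∀ q ∈ Q, ad t q ∈ B :=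
    fun t => Iff.rfl
  have hTn : T.Normal := by
    refine ⟨fun t ht g => ?_⟩
    rw [hT] at ht ⊢
    obtain ⟨h1, h2, h3⟩ := ht
    refine ⟨hQn.conj_mem t h1 g, fun b hb => ?_, fun q hq => ?_⟩
    · have hb' : g⁻¹ * b * g ∈ B := by simpa using hBn.conj_mem b hb g⁻¹
      have := h2 _ hb'
      calc b * (g * t * g⁻¹) = g * ((g⁻¹ * b * g) * t) * g⁻¹ := by group
        _ = _ := by rw [this]; group
    · have hq' : g⁻¹ * q * g ∈ Q := by simpa using hQn.conj_mem q hq g⁻¹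
      have := hBn.conj_mem _ (h3 _ hq') g
      convert this using 1
      simp only [ad]; group
  have hBT : B ≤ T := by
    intro b hb
    rw [hT]
    refine ⟨hBQ hb, fun a ha => hBab a ha b hb, fun q hq => ?_⟩
    have : ad b q = b * (q * b⁻¹ * q⁻¹) := by simp only [ad]; group
    rw [this]
    exact mul_mem hb (hBn.conj_mem _ (inv_mem hb) q)
  have hcent : ∀ b ∈ B, ∀ t ∈ T, b * t = t * b := fun b hb t ht => ((hT t).1 ht).2.1 b hb
  have hcomm : ∀ t ∈ T, ∀ q ∈ Q, ad t q ∈ B := fun t ht => ((hT t).1 ht).2.2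
  have hTQ : T ≤ Q := fun t ht => ((hT t).1 ht).1
  have hCn : (centralizer (T : Set G)).Normal := by infer_instance
  -- the center of T is B
  have hZ : T ⊓ centralizer (T : Set G) ≤ B := by
    refine hmax ⟨inferInstance, inf_le_left.trans hTQ, ?_⟩ ?_
    · rintro a ⟨ha, ha2⟩ b ⟨hb, hb2⟩
      exact mem_centralizer_iff.1 hb2 a ha
    · intro b hb
      exact ⟨hBT hb, mem_centralizer_iff.2 fun t ht => (hcent b hb t ht).symm⟩
  refine ⟨T, B, hTn, hBn, hBT, hTQ, hcent, hcomm, ?_⟩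
  by_contra hcon
  push Not at hcon
  obtain ⟨q, hqQ, hqT, hqB⟩ := hcon
  obtain ⟨E, hE⟩ := (Set.toFinite {E : Subgroup G | E.Normal ∧
    E ≤ Q ⊓ centralizer (T : Set G) ∧ ¬ E ≤ B}).exists_minimal
    ⟨Q ⊓ centralizer (T : Set G), inferInstance, le_rfl,
      fun h => hqB (h ⟨hqQ, mem_centralizer_iff.2 hqT⟩)⟩
  obtain ⟨⟨hEn, hEC, hEB⟩, hEmin⟩ := hE
  have hEne : E ≠ ⊥ := by rintro rfl; exact hEB bot_le
  have hlt := comm_lt Q hQ E (hEC.trans inf_le_left) hEne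
  have hle : ⁅E, Q⁆ ≤ E := commutator_le_left _ _
  have hEQ : ⁅E, Q⁆ ≤ B := by
    by_contra h
    exact hlt (hEmin ⟨inferInstance, hle.trans hEC, h⟩ hle)
  apply hEB
  intro e he
  apply hZ
  refine ⟨(hT e).2 ⟨(hEC he).1, fun b hb => ?_, fun q hq => ?_⟩, (hEC he).2⟩
  · exact mem_centralizer_iff.1 (hEC he).2 b (hBT hb)
  · exact hEQ (commutator_mem_commutator he hq)

lemma L2 (hp5 : 5 ≤ p) (Q T B : Subgroup G) [hQn : Q.Normal] (hQ : IsPGroup p Q)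
    (hc : Crit Q T B) (x : G) (hT : ∀ t ∈ T, (ad x)^[3] t = 1) (hB : ∀ t ∈ B, (ad x)^[2] t = 1) :
    Chain p x Q := by
  have := hc.hTn
  have := hc.hBn
  have hBQ := hc.hBT.trans hc.hTQ
  have hBab : ∀ a ∈ B, ∀ b ∈ B, a * b = b * a := fun a ha b hb => hc.hcent a ha b (hc.hBT hb)
  have cB : Chain p x B := by
    refine Chain.step B ⊥ inferInstance Chain.bot bot_le fun y hy => ?_
    refine ad_iter_mono x ⊥ (m := 2) (by omega) ?_
    rw [hB y hy]; exact one_mem _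
  have cCB : Chain p x (Q ⊓ centralizer (B : Set G)) := by
    refine Chain.step _ B inferInstance cB ?_ fun y hy => ?_
    · intro b hb
      exact ⟨hBQ hb, mem_centralizer_iff.2 fun a ha => hBab a ha b hb⟩
    · have h := L1 x T B (Q ⊓ centralizer (B : Set G)) hc.hBT hc.hcent
        (fun d hd v hv => (mem_centralizer_iff.1 hd.2 v hv).symm)
        (fun u hu d hd => hc.hcomm u hu d hd.1) 3 2 (by norm_num) hT hB y hy
      refine ad_iter_mono x B (m := 3 + 2 - 1) (by omega) ?_
      refine hc.hself _ (ad_iter_mem x Q _ hy.1) fun t ht => ?_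
      exact ad_eq_one.1 (h t ht)
  have main : ∀ n : ℕ, ∀ U : Subgroup G, U.Normal → U ≤ B → Nat.card U ≤ n →
      Chain p x (Q ⊓ centralizer (U : Set G)) → Chain p x Q := by
    intro n
    induction n with
    | zero =>
      intro U _ _ h
      have : 0 < Nat.card U := Nat.card_pos
      omega
    | succ n ih =>
      intro U hU hUB hcard hch
      by_cases hne : U = ⊥
      · subst hne
        have e : Q ⊓ centralizer (((⊥ : Subgroup G)) : Set G) = Q := by
          rw [inf_eq_left]
          intro q _
          rw [mem_centralizer_iff]
          simp
        rwa [e] at hch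
      · have hlt := comm_lt Q hQ U (hUB.trans hBQ) hne
        have hle : ⁅U, Q⁆ ≤ U := commutator_le_left _ _
        refine ih ⁅U, Q⁆ inferInstance (hle.trans hUB) ?_ ?_
        · have : Nat.card (⁅U, Q⁆ : Subgroup G) < Nat.card U := by
            by_contra h
            exact hlt (Subgroup.eq_of_le_of_card_ge hle (by omega)).ge
          omega
        · refine Chain.step _ _ inferInstance hch ?_ fun y hy => ?_
          · refine inf_le_inf le_rfl (centralizer_le ?_)
            exact hle
          · have h := L1 x U ⁅U, Q⁆ (Q ⊓ centralizer ((⁅U, Q⁆ : Subgroup G) : Set G)) hle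
              (fun v hv u hu => hBab v (hUB (hle hv)) u (hUB hu))
              (fun d hd v hv => (mem_centralizer_iff.1 hd.2 v hv).symm)
              (fun u hu d hd => commutator_mem_commutator hu hd.1) 2 2 (by norm_num)
              (fun u hu => hB u (hUB hu)) (fun u hu => hB u (hUB (hle hu))) y hy
            refine ad_iter_mono x _ (m := 2 + 2 - 1) (by omega) ?_
            refine ⟨ad_iter_mem x Q _ hy.1, mem_centralizer_iff.2 fun t ht => ?_⟩
            exact ad_eq_one.1 (h t ht)
  exact main _ B inferInstance le_rfl le_rfl cCB

lemma comparison (hp5 : 5 ≤ p) (P Q : Subgroup G) [hQn : Q.Normal] (hQ : IsPGroup p Q)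
    (hQP : Q ≤ P) (hx : ∀ x ∈ P, Chain p x Q → x ∈ Q) : WW P = WW Q := by
  obtain ⟨T, B, hc⟩ := exists_crit Q hQ
  have hTn := hc.hTn
  have hBn := hc.hBn
  have hBab : ∀ a ∈ B, ∀ b ∈ B, a * b = b * a := fun a ha b hb => hc.hcent a ha b (hc.hBT hb)
  have F1 : ∀ M : Subgroup G, M ≤ P → (∀ a ∈ M, ∀ b ∈ M, a * b = b * a) →
      (∀ r ∈ T, ∀ m ∈ M, r * m * r⁻¹ ∈ M) → M ≤ Q := by
    intro M hMP hab hTM x hxM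
    have h2 : ∀ t ∈ T, (ad x)^[2] t = 1 := by
      intro t ht
      change ad x (ad x t) = 1
      rw [ad_eq_one]
      apply hab x hxM
      have : ad x t = x * (t * x⁻¹ * t⁻¹) := by simp only [ad]; group
      rw [this]
      exact mul_mem hxM (hTM t ht _ (inv_mem hxM))
    refine hx x (hMP hxM) (L2 hp5 Q T B hQ hc x (fun t ht => ?_) fun t ht => h2 t (hc.hBT ht))
    rw [Function.iterate_succ_apply', h2 t ht, ad_one]
  have F2 : ∀ R M : Subgroup G, T ≤ R → CondE P R M → M ≤ Q := by
    rintro R M hTR ⟨hMP, h1, h2, h3⟩ x hxM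
    refine hx x (hMP hxM) (L2 hp5 Q T B hQ hc x (fun t ht => ?_) fun t ht => ?_)
    · change ad x (ad x (ad x t)) = 1
      apply h2 x hxM x hxM
      have : ad x t = x * (t * x⁻¹ * t⁻¹) := by simp only [ad]; group
      rw [this]
      exact mul_mem hxM (h1 t (hTR ht) _ (inv_mem hxM))
    · exact h3 B (hc.hBT.trans hTR) hBab (fun m _ n hn => hBn.conj_mem n hn m) x hxM x hxM t ht
  have hadT : ∀ a ∈ T, ∀ b ∈ T, ∀ q ∈ Q, ad a (ad b q) = 1 := fun a ha b hb q hq =>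
    ad_eq_one.2 (hc.hcent _ (hc.hcomm b hb q hq) a ha).symm
  have F3 : CondE P P T := by
    refine ⟨hc.hTQ.trans hQP, fun r _ m hm => hTn.conj_mem m hm r,
      fun a ha b hb c hc' => hadT a ha b hb c (hc.hTQ hc'), ?_⟩
    intro N hNP hab hTN a ha b hb n hn
    exact hadT a ha b hb n (F1 N hNP hab hTN hn)
  have F3' : CondE Q Q T := by
    refine ⟨hc.hTQ, fun r _ m hm => hTn.conj_mem m hm r,
      fun a ha b hb c hc' => hadT a ha b hb c (hc.hTQ hc'), ?_⟩
    intro N hNP hab hTN a ha b hb n hn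
    exact hadT a ha b hb n (hNP hn)
  have F4 : ∀ R : Subgroup G, R ≤ Q → T ≤ OO Q R := by
    intro R hR t ht
    have hcond : CondO Q R (zpowers t ⊔ B) := by
      have hmem : ∀ m, m ∈ zpowers t ⊔ B ↔ ∃ i : ℤ, ∃ b ∈ B, t ^ i * b = m := by
        intro m
        rw [mem_sup_of_normal_right]
        simp only [mem_zpowers_iff, exists_exists_eq_and]
      refine ⟨sup_le (zpowers_le.2 (hc.hTQ ht)) (hc.hBT.trans hc.hTQ), ?_, ?_⟩
      · intro u hu v hv
        rw [hmem] at hu hv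
        obtain ⟨i, a, ha, rfl⟩ := hu
        obtain ⟨j, b, hb, rfl⟩ := hv
        have ca : Commute a (t ^ j) := Commute.zpow_right (hc.hcent a ha t ht) j
        have cb : Commute b (t ^ i) := Commute.zpow_right (hc.hcent b hb t ht) i
        have cab : Commute a b := hBab a ha b hb
        have ctt : Commute (t ^ i) (t ^ j) := Commute.zpow_zpow_self t i j
        exact (Commute.mul_left (ctt.mul_right cb.symm) (ca.mul_right cab)).eq
      · intro r hr m hm
        rw [hmem] at hm
        obtain ⟨i, b, hb, rfl⟩ := hm
        have hti : t ^ i ∈ T := zpow_mem ht i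
        have e : r * (t ^ i * b) * r⁻¹ = (ad (t ^ i) r)⁻¹ * (t ^ i) * (r * b * r⁻¹) := by
          simp only [ad]; group
        rw [e]
        refine mul_mem (mul_mem (mem_sup_right (inv_mem (hc.hcomm _ hti r (hR hr))))
          (mem_sup_left (zpow_mem (mem_zpowers t) i))) (mem_sup_right (hBn.conj_mem b hb r))
    exact (le_sSup (a := zpowers t ⊔ B) hcond : _) (mem_sup_left (mem_zpowers t))
  have hO : ∀ R, T ≤ R → OO P R = OO Q R := by
    intro R hTR
    apply le_antisymm
    · exact sSup_le_sSup fun M hM => ⟨F1 M hM.1 hM.2.1 fun r hr => hM.2.2 r (hTR hr), hM.2⟩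
    · exact sSup_le_sSup fun M hM => ⟨hM.1.trans hQP, hM.2⟩
  have hE : ∀ R, T ≤ R → EE P R = EE Q R := by
    intro R hTR
    apply le_antisymm
    · exact sSup_le_sSup fun M hM => ⟨F2 R M hTR hM, hM.2⟩
    · exact sSup_le_sSup fun M hM => ⟨hM.1.trans hQP, hM.2⟩
  have hTP : T ≤ WW P := (le_sSup (a := T) F3).trans (EE_le_WW P)
  have hTQ' : T ≤ WW Q := (le_sSup (a := T) F3').trans (EE_le_WW Q)
  have hle : WW P ≤ WW Q := by
    apply WW_min _ _ ((WW_le Q).trans hQP)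
    rw [hO _ hTQ', hE _ (F4 _ (WW_le Q))]
    exact WW_pre Q
  apply le_antisymm hle
  have hPQ : WW P ≤ Q := hle.trans (WW_le Q)
  apply WW_min _ _ hPQ
  rw [← hO _ hTP, ← hE]
  · exact WW_pre P
  · rw [hO _ hTP]; exact F4 _ hPQ

lemma WW_normal {G : Type*} [Group G] (Q : Subgroup G) [hQn : Q.Normal] : (WW Q).Normal := by
  refine ⟨fun n hn g => ?_⟩
  have h := WW_conj Q g
  have e : Q.map (MulAut.conj g).toMonoidHom = Q := by
    apply Subgroup.ext
    intro y
    constructor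
    · rintro ⟨z, hz, rfl⟩
      exact hQn.conj_mem z hz g
    · intro hy
      exact ⟨g⁻¹ * y * g, by simpa using hQn.conj_mem y hy g⁻¹, by simp [mul_assoc]⟩
  rw [e] at h
  rw [h]
  exact ⟨n, hn, rfl⟩

end crit
end SNT

namespace SNT

abbrev AA (p : ℕ) := Multiplicative (ZMod p)

lemma AA_pow (p : ℕ) (a : AA p) : a ^ p = 1 := by
  apply Multiplicative.toAdd.injective
  rw [toAdd_pow]
  simp

section basics
variable {G : Type*} [Group G] {p : ℕ}

def HomOn (P : Subgroup G) (t : G → AA p) : Prop := ∀ u ∈ P, ∀ v ∈ P, t (u * v) = t u * t v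

def StableOn (H P : Subgroup G) (t : G → AA p) : Prop :=
  ∀ h ∈ H, ∀ u ∈ P, h * u * h⁻¹ ∈ P → t (h * u * h⁻¹) = t u

def HomOn.toHom {P : Subgroup G} {t : G → AA p} (h : HomOn P t) : P →* AA p :=
  MonoidHom.mk' (fun u => t u) fun u v => h u u.2 v v.2

lemma HomOn.toHom_apply {P : Subgroup G} {t : G → AA p} (h : HomOn P t) (u : P) :
    h.toHom u = t u := rfl

lemma HomOn.one {P : Subgroup G} {t : G → AA p} (h : HomOn P t) : t 1 = 1 :=
  map_one h.toHom

lemma HomOn.inv {P : Subgroup G} {t : G → AA p} (h : HomOn P t) {u : G} (hu : u ∈ P) :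
    t u⁻¹ = (t u)⁻¹ := map_inv h.toHom ⟨u, hu⟩

lemma HomOn.pow {P : Subgroup G} {t : G → AA p} (h : HomOn P t) {u : G} (hu : u ∈ P) (n : ℕ) :
    t (u ^ n) = (t u) ^ n := map_pow h.toHom ⟨u, hu⟩ n

lemma HomOn.conj {P : Subgroup G} {t : G → AA p} (h : HomOn P t) {u v : G} (hu : u ∈ P)
    (hv : v ∈ P) : t (u * v * u⁻¹) = t v := by
  rw [h _ (mul_mem hu hv) _ (inv_mem hu), h u hu v hv, h.inv hu]
  simp

lemma HomOn.mono {P P' : Subgroup G} {t : G → AA p} (h : HomOn P t) (hle : P' ≤ P) :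
    HomOn P' t := fun u hu v hv => h u (hle hu) v (hle hv)

lemma StableOn.mono {H H' P P' : Subgroup G} {t : G → AA p} (h : StableOn H P t)
    (hle : H' ≤ H) (hP : P' ≤ P) : StableOn H' P' t :=
  fun g hg u hu hv => h g (hle hg) u (hP hu) (hP hv)

lemma StableOn.congr {H P : Subgroup G} {t t' : G → AA p} (h : StableOn H P t)
    (he : ∀ u ∈ P, t u = t' u) : StableOn H P t' :=
  fun g hg u hu hv => by rw [← he _ hv, ← he _ hu]; exact h g hg u hu hv

lemma mem_norm_of_le [Finite G] (Z : Subgroup G) (g : G) (h : ∀ z ∈ Z, g * z * g⁻¹ ∈ Z) :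
    g ∈ normalizer (Z : Set G) := by
  rw [mem_normalizer_iff_map_conj_eq]
  apply Subgroup.eq_of_le_of_card_ge
  · rintro _ ⟨z, hz, rfl⟩
    exact h z hz
  · exact (Subgroup.card_map_of_injective (MulAut.conj g).injective).ge

lemma exists_norm [Finite G] [Fact p.Prime] (P K : Subgroup G) (hP : IsPGroup p P) (hK : K < P) :
    ∃ g ∈ P, g ∉ K ∧ g ∈ normalizer (K : Set G) := by
  have hn : Group.IsNilpotent P := hP.isNilpotent
  have hlt : K.subgroupOf P < ⊤ := by
    rw [lt_top_iff_ne_top]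
    intro h
    exact hK.not_ge (subgroupOf_eq_top.1 h)
  have := Group.normalizerCondition_of_isNilpotent (G := P) _ hlt
  obtain ⟨g, hg, hgK⟩ := SetLike.exists_of_lt this
  refine ⟨g, g.2, fun h => hgK h, mem_norm_of_le K g fun z hz => ?_⟩
  exact (mem_normalizer_iff.1 hg ⟨z, hK.le hz⟩).1 hz

/-- extension of stable homomorphisms -/
lemma extend [Finite G] [Fact p.Prime] (P : Sylow p G) (t : G → AA p) (ht : HomOn (P : Subgroup G) t)
    (hs : StableOn ⊤ (P : Subgroup G) t) : ∃ Θ : G →* AA p, ∀ u ∈ P, Θ u = t u := by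
  classical
  have hidx : (P : Subgroup G).index.Coprime p :=
    ((Nat.Prime.coprime_iff_not_dvd (Fact.out)).2 P.not_dvd_index).symm
  obtain ⟨m, -, hm⟩ := Nat.exists_mul_mod_eq_one_of_coprime hidx (Nat.Prime.one_lt Fact.out)
  have key : ∀ u ∈ P, MonoidHom.transfer ht.toHom u = t u ^ (P : Subgroup G).index := by
    intro u hu
    let _ := (P : Subgroup G).fintypeQuotientOfFiniteIndex
    rw [MonoidHom.transfer_eq_prod_quotient_orbitRel_zpowers_quot,
      index_eq_sum_minimalPeriod (P : Subgroup G) u, ← Finset.prod_pow_eq_pow_sum]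
    refine Finset.prod_congr rfl fun q _ => ?_
    rw [HomOn.toHom_apply, ← ht.pow hu]
    have := hs (q.out.out)⁻¹ trivial (u ^ Function.minimalPeriod (u • ·) q.out) (pow_mem hu _)
    simp only [inv_inv] at this
    exact this (QuotientGroup.out_conj_pow_minimalPeriod_mem _ u q.out)
  refine ⟨(MonoidHom.transfer ht.toHom) ^ m, fun u hu => ?_⟩
  rw [MonoidHom.pow_apply, key u hu, ← pow_mul, ← Nat.div_add_mod ((P : Subgroup G).index * m) p,
    hm, pow_add, pow_mul, AA_pow]
  simp
end basics

section sums
variable {p : ℕ} [hp : Fact p.Prime]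

lemma sum_block (f : ℕ → ZMod p) (h : (fwdDiff 1)^[p - 1] f = 0) :
    ∑ i ∈ Finset.range p, f i = 0 := by
  let F : ℕ → ZMod p := fun n => ∑ i ∈ Finset.range n, f i
  have hF : fwdDiff 1 F = f := by
    funext n
    simp [fwdDiff, F, Finset.sum_range_succ]
  have h2 := shift_eq_sum_fwdDiff_iter (h := 1) F p 0
  have hp1 : p = (p - 1) + 1 := by have := hp.out.pos; omega
  have e : (fwdDiff 1)^[p] F = 0 := by
    have : ∀ m, m = (p - 1) + 1 → (fwdDiff 1)^[m] F = 0 := by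
      rintro m rfl
      rw [Function.iterate_succ_apply, hF, h]
    exact this p hp1
  have hF0 : F 0 = 0 := by simp [F]
  simp only [smul_eq_mul, mul_one, zero_add] at h2
  change F p = 0
  rw [h2]
  refine Finset.sum_eq_zero fun k hk => ?_
  rw [Finset.mem_range] at hk
  rcases Nat.eq_zero_or_pos k with rfl | hk0
  · simp [hF0]
  · rcases Nat.lt_or_ge k p with hkp | hkp
    · have := hp.out.dvd_choose_self hk0.ne' hkp
      rw [nsmul_eq_mul, (ZMod.natCast_eq_zero_iff _ _).2 this, zero_mul]
    · have : k = p := by omega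
      rw [this, e]; simp

lemma sum_blocks (f : ℕ → ZMod p) (h : ∀ j, ∑ i ∈ Finset.range p, f (j + i) = 0) (m : ℕ) :
    ∑ i ∈ Finset.range (p * m), f i = 0 := by
  induction m with
  | zero => simp
  | succ m ih => rw [mul_add, mul_one, Finset.sum_range_add, ih, h, add_zero]

lemma perm_sum {α : Type*} [DecidableEq α] (σ : Equiv.Perm α) (k : ℕ)
    (hσ : ∀ a, σ^[p ^ k] a = a) (F : α → ZMod p)
    (h : ∀ a, ∑ i ∈ Finset.range p, F (σ^[i] a) = 0) (n : ℕ) :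
    ∀ S : Finset α, S.card ≤ n → (∀ a ∈ S, σ a ∈ S) →
      ∑ a ∈ S, F a = ∑ a ∈ S.filter (fun a => σ a = a), F a := by
  induction n with
  | zero =>
    intro S hS _
    have : S = ∅ := Finset.card_eq_zero.1 (by omega)
    simp [this]
  | succ n ih =>
    intro S hS hinv
    by_cases hfix : ∀ a ∈ S, σ a = a
    · rw [Finset.filter_true_of_mem hfix]
    push Not at hfix
    obtain ⟨a, haS, ha⟩ := hfix
    set N := Function.minimalPeriod σ a with hN
    have hNdvd : N ∣ p ^ k := Function.IsPeriodicPt.minimalPeriod_dvd (hσ a)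
    have hN1 : N ≠ 1 := by
      intro h1
      exact ha (Function.minimalPeriod_eq_one_iff_isFixedPt.1 h1)
    have hpN : p ∣ N := by
      obtain ⟨j, hj, hj2⟩ := (Nat.dvd_prime_pow hp.out).1 hNdvd
      rw [hj2]
      apply dvd_pow_self
      rintro rfl
      exact hN1 (by simpa using hj2)
    have hNpos : 0 < N := Nat.pos_of_dvd_of_pos hNdvd (pow_pos hp.out.pos _)
    let O := (Finset.range N).image (fun i => σ^[i] a)
    have hO : ∀ b, b ∈ O ↔ ∃ i, σ^[i] a = b := by
      intro b
      simp only [O, Finset.mem_image, Finset.mem_range]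
      constructor
      · rintro ⟨i, _, h⟩; exact ⟨i, h⟩
      · rintro ⟨i, h⟩
        exact ⟨i % N, Nat.mod_lt _ hNpos, by rw [Function.iterate_mod_minimalPeriod_eq, h]⟩
    have hOS : O ⊆ S := by
      intro b hb
      obtain ⟨i, rfl⟩ := (hO b).1 hb
      clear hb
      induction i with
      | zero => exact haS
      | succ i ihi => rw [Function.iterate_succ_apply']; exact hinv _ ihi
    have hOF : ∑ b ∈ O, F b = 0 := by
      rw [Finset.sum_image]
      · obtain ⟨m, hm⟩ := hpN
        rw [hm]
        refine sum_blocks _ (fun j => ?_) m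
        have := h (σ^[j] a)
        simpa [← Function.iterate_add_apply, add_comm] using this
      · intro i hi j hj hij
        simp only [Finset.coe_range, Set.mem_Iio] at hi hj
        exact Function.iterate_injOn_Iio_minimalPeriod hi hj hij
    have hsub : ∑ b ∈ S \ O, F b = ∑ b ∈ S, F b := by
      rw [← Finset.sum_sdiff hOS, hOF, add_zero]
    have hne : a ∈ O := (hO a).2 ⟨0, rfl⟩
    rw [← hsub, ih (S \ O) ?_ ?_]
    · apply Finset.sum_congr _ fun _ _ => rfl
      ext b
      simp only [Finset.mem_filter, Finset.mem_sdiff]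
      constructor
      · rintro ⟨⟨h1, _⟩, h2⟩; exact ⟨h1, h2⟩
      · rintro ⟨h1, h2⟩
        refine ⟨⟨h1, fun hbO => ?_⟩, h2⟩
        obtain ⟨i, rfl⟩ := (hO b).1 hbO
        apply ha
        rw [← Function.iterate_succ_apply' (f := σ), Function.iterate_succ_apply] at h2
        exact (σ.injective.iterate i) h2
    · have h1 := Finset.card_lt_card (Finset.sdiff_ssubset hOS ⟨a, hne⟩)
      omega
    · intro b hb
      rw [Finset.mem_sdiff] at hb ⊢
      refine ⟨hinv b hb.1, fun hc => hb.2 ?_⟩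
      obtain ⟨i, hi⟩ := (hO _).1 hc
      rw [hO]
      refine ⟨i + (N - 1), σ.injective ?_⟩
      rw [← Function.iterate_succ_apply' (f := σ), ← hi]
      have : (i + (N - 1)).succ = i + N := by omega
      rw [this, Function.iterate_add_apply, Function.iterate_minimalPeriod]

end sums

end SNT

namespace SNT

section transfer
variable {G : Type*} [Group G] [Finite G] {p : ℕ} [hp : Fact p.Prime]

lemma mem_smul_sylow {G : Type*} [Group G] {p : ℕ} (P : Sylow p G) (g x : G) :
    x ∈ g • P ↔ g⁻¹ * x * g ∈ P := by
  have : x ∈ g • P ↔ x ∈ (g • P : Sylow p G).toSubgroup := Iff.rfl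
  rw [this, Sylow.coe_subgroup_smul, Subgroup.mem_pointwise_smul_iff_inv_smul_mem, ← map_inv,
    MulAut.smul_def, MulAut.conj_apply, inv_inv]
  rfl

lemma sylow_conj_le (N : Subgroup G) (X : Sylow p N) (R : Subgroup G) (hRN : R ≤ N)
    (hR : IsPGroup p R) :
    ∃ n ∈ N, ∀ r ∈ R, n⁻¹ * r * n ∈ (X : Subgroup N).map N.subtype := by
  have h1 : IsPGroup p (R.subgroupOf N) := hR.comap_of_injective N.subtype N.subtype_injective
  obtain ⟨Q, hQ⟩ := h1.exists_le_sylow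
  obtain ⟨n, rfl⟩ := MulAction.exists_smul_eq N X Q
  refine ⟨n, n.2, fun r hr => ?_⟩
  have : (⟨r, hRN hr⟩ : N) ∈ n • X := hQ hr
  rw [mem_smul_sylow] at this
  exact ⟨_, this, rfl⟩

lemma conj_closure {G : Type*} [Group G] (X : Set G) (S : Subgroup G) (g : G)
    (h : ∀ x ∈ X, g * x * g⁻¹ ∈ S) : ∀ z ∈ closure X, g * z * g⁻¹ ∈ S := by
  have : closure X ≤ S.comap (MulAut.conj g).toMonoidHom := (closure_le _).2 h
  exact this

lemma exists_next (P : Subgroup G) (hP : IsPGroup p P) (X : Set G) (hXP : X ⊆ P)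
    (hX : ∀ g ∈ P, ∀ x ∈ X, g * x * g⁻¹ ∈ X) (Z : Subgroup G)
    (hZ : Z = closure ((Z : Set G) ∩ X)) (hne : ¬ X ⊆ Z) :
    ∃ x ∈ X, x ∉ Z ∧ x ∈ normalizer (Z : Set G) := by
  by_contra hcon
  push Not at hcon
  have hall : ∀ x ∈ X, x ∈ normalizer (Z : Set G) → x ∈ Z := fun x hx hn => by
    by_contra h; exact hcon x hx h hn
  rcases (inf_le_left : P ⊓ normalizer (Z : Set G) ≤ P).eq_or_lt with h | h
  · exact hne fun x hx => hall x hx (inf_eq_left.1 h (hXP hx))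
  · obtain ⟨g, hgP, hgK, hgn⟩ := exists_norm P _ hP h
    refine hgK ⟨hgP, mem_norm_of_le Z g ?_⟩
    have : ∀ x ∈ (Z : Set G) ∩ X, g * x * g⁻¹ ∈ Z := by
      rintro x ⟨hxZ, hxX⟩
      refine hall _ (hX g hgP x hxX) ?_
      exact ((mem_normalizer_iff.1 hgn x).1 ⟨hXP hxX, le_normalizer hxZ⟩).2
    intro z hz
    rw [hZ] at hz
    exact conj_closure _ Z g this z hz

lemma transfer_normal (H : Subgroup G) (ψ : G → AA p) (hψ : HomOn H ψ) (D : Subgroup G)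
    [hD : D.Normal] (hDH : D ≤ H) (d : G) (hd : d ∈ D) (F : G ⧸ H → AA p)
    (hF : ∀ g : G, F g = ψ (g⁻¹ * d * g)) [Fintype (G ⧸ H)] :
    MonoidHom.transfer hψ.toHom d = ∏ q, F q := by
  rw [MonoidHom.transfer_def hψ.toHom default d]
  unfold leftTransversals.diff
  refine Finset.prod_congr (by ext; simp) fun q _ => ?_
  rw [HomOn.toHom_apply]
  simp only
  rw [smul_apply_eq_smul_apply_inv_smul]
  have hfix : ∀ q : G ⧸ H, d⁻¹ • q = q := by
    intro q
    induction q using QuotientGroup.induction_on with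
    | H g =>
      change ((d⁻¹ * g : G) : G ⧸ H) = g
      rw [QuotientGroup.eq]
      apply hDH
      simpa [mul_assoc] using hD.conj_mem d hd g⁻¹
  rw [hfix q]
  have hq := IsComplement.quotientGroupMk_leftQuotientEquiv (default : H.LeftTransversal).2 q
  have h2 := hF ((default : H.LeftTransversal).2.leftQuotientEquiv q)
  have hq' : (((default : H.LeftTransversal).2.leftQuotientEquiv q : G) : G ⧸ H) = q := hq
  rw [hq'] at h2
  rw [h2, smul_eq_mul, mul_assoc]

set_option linter.unusedSectionVars false in
set_option linter.unusedVariables false in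
lemma block (z g d : G) (H D D' : Subgroup G) [hD : D.Normal] [hD' : D'.Normal] (hDH : D ≤ H)
    (hle : D' ≤ D) (hstep : ∀ y ∈ D, (ad z)^[p - 1] y ∈ D') (ψ : G → AA p) (hψ : HomOn H ψ)
    (h1 : ∀ y ∈ D', ψ y = 1) (hd : d ∈ D) :
    ∑ i ∈ Finset.range p, Multiplicative.toAdd (ψ (g⁻¹ * (z ^ i * d * (z ^ i)⁻¹) * g)) = 0 := by
  apply sum_block (fun i => Multiplicative.toAdd (ψ (g⁻¹ * (z ^ i * d * (z ^ i)⁻¹) * g)))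
  have hmem : ∀ (E : Subgroup G) [E.Normal] (y : G), y ∈ E → ∀ i : ℕ,
      g⁻¹ * (z ^ i * y * (z ^ i)⁻¹) * g ∈ E := by
    intro E hE y hy i
    simpa using hE.conj_mem _ (hE.conj_mem y hy (z ^ i)) g⁻¹
  have hit : ∀ (k : ℕ) (y : G), y ∈ D →
      (fwdDiff 1)^[k] (fun i : ℕ => Multiplicative.toAdd (ψ (g⁻¹ * (z ^ i * y * (z ^ i)⁻¹) * g)))
      = fun i : ℕ =>
        Multiplicative.toAdd (ψ (g⁻¹ * (z ^ i * (ad z)^[k] y * (z ^ i)⁻¹) * g)) := by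
    intro k
    induction k with
    | zero => intro y _; rfl
    | succ k ih =>
      intro y hy
      rw [Function.iterate_succ_apply, Function.iterate_succ_apply, ← ih _ (ad_mem z D hy)]
      congr 1
      funext i
      rw [fwdDiff, ← toAdd_div, div_eq_mul_inv, ← hψ.inv (hDH (hmem D y hy i)),
        ← hψ _ (hDH (hmem D y hy (i+1))) _ (inv_mem (hDH (hmem D y hy i)))]
      congr 2
      simp only [ad, pow_succ]
      group
  rw [hit _ d hd]
  funext i
  rw [h1 _ (hmem D' _ (hstep d hd) i)]
  rfl

lemma trans_step (P : Sylow p G) (x : G) (X : Set G) (hX : X = {u | u ∈ P ∧ IsConj x u})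
    (H : Subgroup G) (hH : H = normalizer (closure X : Set G)) (D D' : Subgroup G)
    [hD : D.Normal] [hD' : D'.Normal] (hDP : D ≤ P) (hle : D' ≤ D)
    (hstep : ∀ y ∈ D, (ad x)^[p - 1] y ∈ D') (ψ : G → AA p) (hψ : HomOn H ψ)
    (h1 : ∀ y ∈ D', ψ y = 1) : ∃ V : G →* AA p, ∀ d ∈ D, V d = ψ d := by
  classical
  have hXP : X ⊆ (P : Subgroup G) := by rw [hX]; exact fun u hu => hu.1
  have hXc : ∀ g ∈ P, ∀ u ∈ X, g * u * g⁻¹ ∈ X := by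
    rw [hX]
    rintro g hg u ⟨hu, hc⟩
    exact ⟨mul_mem (mul_mem hg hu) (inv_mem hg), hc.trans (isConj_iff.2 ⟨g, rfl⟩)⟩
  have hPH : (P : Subgroup G) ≤ H := by
    intro g hg
    rw [hH]
    exact mem_norm_of_le _ g (conj_closure X _ g fun u hu => subset_closure (hXc g hg u hu))
  have hDH : D ≤ H := hDP.trans hPH
  let _ : Fintype (G ⧸ H) := Fintype.ofFinite _
  refine ⟨MonoidHom.transfer hψ.toHom, fun d hd => ?_⟩
  let F : G ⧸ H → AA p := fun q => ψ (q.out⁻¹ * d * q.out)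
  have hF : ∀ g : G, F g = ψ (g⁻¹ * d * g) := by
    intro g
    obtain ⟨h, hh⟩ := QuotientGroup.mk_out_eq_mul H g
    have hm : g⁻¹ * d * g ∈ H := hDH (by simpa using hD.conj_mem d hd g⁻¹)
    have := hψ.conj (inv_mem h.2) hm
    rw [← this]
    change ψ ((g : G ⧸ H).out⁻¹ * d * (g : G ⧸ H).out) = _
    rw [hh]
    congr 1
    group
  rw [transfer_normal H ψ hψ D hDH d hd F hF]
  apply Multiplicative.toAdd.injective
  rw [toAdd_prod]
  -- reduction to fixed points
  have red : ∀ z ∈ X, ∀ S : Finset (G ⧸ H), (∀ q ∈ S, z⁻¹ • q ∈ S) →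
      ∑ q ∈ S, Multiplicative.toAdd (F q) =
        ∑ q ∈ S.filter (fun q => z⁻¹ • q = q), Multiplicative.toAdd (F q) := by
    intro z hz S hS
    have hstep' : ∀ y ∈ D, (ad z)^[p - 1] y ∈ D' := by
      rw [hX] at hz
      obtain ⟨c, rfl⟩ := isConj_iff.1 hz.2
      intro y hy
      have hit : ∀ (k : ℕ) (y : G), (ad (c * x * c⁻¹))^[k] (c * y * c⁻¹) =
          c * (ad x)^[k] y * c⁻¹ := by
        intro k
        induction k with
        | zero => intro y; rfl
        | succ k ih =>
          intro y
          rw [Function.iterate_succ_apply, Function.iterate_succ_apply, ← ih]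
          congr 1
          simp only [ad]; group
      have h2 := hit (p - 1) (c⁻¹ * y * c)
      have e : c * (c⁻¹ * y * c) * c⁻¹ = y := by group
      rw [e] at h2
      rw [h2]
      exact hD'.conj_mem _ (hstep _ (by simpa using hD.conj_mem y hy c⁻¹)) c
    have hiter : ∀ (i : ℕ) (q : G ⧸ H), (MulAction.toPerm z⁻¹)^[i] q = (z⁻¹) ^ i • q := by
      intro i q
      rw [← smul_iterate_apply]
      rfl
    obtain ⟨k, hk⟩ := P.isPGroup' ⟨z, hXP hz⟩
    have hk' : z ^ p ^ k = 1 := congrArg Subtype.val hk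
    refine perm_sum (MulAction.toPerm z⁻¹) k ?_ (fun q => Multiplicative.toAdd (F q)) ?_ _ S
      le_rfl hS
    · intro q
      rw [hiter, inv_pow, hk', inv_one, one_smul]
    · intro q
      induction q using QuotientGroup.induction_on with
      | H g =>
      rw [← block (p := p) z g d H D D' hDH hle hstep' ψ hψ h1 hd]
      refine Finset.sum_congr rfl fun i _ => ?_
      rw [hiter]
      change Multiplicative.toAdd (F (((z⁻¹ ^ i * g : G)) : G ⧸ H)) = _
      rw [hF]
      congr 2
      group
  -- maximal Z
  obtain ⟨Z, ⟨hZX, hZs⟩, hZmax⟩ := (Set.toFinite {Z : Subgroup G |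
    Z = closure ((Z : Set G) ∩ X) ∧ ∑ q, Multiplicative.toAdd (F q) =
      ∑ q ∈ Finset.univ.filter (fun q : G ⧸ H => ∀ z ∈ Z, z • q = q),
        Multiplicative.toAdd (F q)}).exists_maximal ⟨⊥, by
      refine ⟨?_, ?_⟩
      · symm
        rw [closure_eq_bot_iff]
        exact fun y hy => hy.1
      · refine Finset.sum_congr ?_ fun _ _ => rfl
        symm
        rw [Finset.filter_eq_self]
        intro q _ z hz
        rw [mem_bot] at hz
        rw [hz, one_smul]⟩
  have hXZ : X ⊆ Z := by
    by_contra hne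
    obtain ⟨u, huX, huZ, hun⟩ := exists_next (P : Subgroup G) P.isPGroup' X hXP hXc Z hZX hne
    apply huZ
    have hle' : Z ≤ Z ⊔ zpowers u := le_sup_left
    refine hZmax (y := Z ⊔ zpowers u) ⟨?_, ?_⟩ hle' (mem_sup_right (mem_zpowers u))
    · apply le_antisymm
      · refine sup_le ?_ ?_
        · conv_lhs => rw [hZX]
          exact closure_mono (Set.inter_subset_inter_left _ hle')
        · rw [zpowers_le]
          exact subset_closure ⟨mem_sup_right (mem_zpowers u), huX⟩
      · rw [closure_le]
        exact Set.inter_subset_left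
    · rw [hZs, red u huX]
      · refine Finset.sum_congr ?_ fun _ _ => rfl
        ext q
        simp only [Finset.mem_filter, Finset.mem_univ, true_and]
        constructor
        · rintro ⟨h1, h2⟩
          have : Z ⊔ zpowers u ≤ MulAction.stabilizer G q := by
            refine sup_le (fun z hz => h1 z hz) ?_
            rw [zpowers_le]
            exact inv_mem_iff.1 (MulAction.mem_stabilizer_iff.2 h2)
          exact fun z hz => this hz
        · intro h
          exact ⟨fun z hz => h z (hle' hz), h _ (inv_mem (mem_sup_right (mem_zpowers u)))⟩
      · intro q hq
        simp only [Finset.mem_filter, Finset.mem_univ, true_and] at hq ⊢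
        intro z hz
        have : u * z * u⁻¹ ∈ Z := (mem_normalizer_iff.1 hun z).1 hz
        have h3 := hq _ this
        rw [smul_smul, show z * u⁻¹ = u⁻¹ * (u * z * u⁻¹) by group, mul_smul, h3]
  have hYZ : closure X ≤ Z := (closure_le _).2 hXZ
  have hZP : Z ≤ closure X := by
    rw [hZX]; exact closure_mono Set.inter_subset_right
  have hYP : closure X ≤ P := (closure_le _).2 hXP
  have hfil : Finset.univ.filter (fun q : G ⧸ H => ∀ z ∈ Z, z • q = q) = {((1 : G) : G ⧸ H)} := by
    ext q
    simp only [Finset.mem_filter, Finset.mem_univ, true_and, Finset.mem_singleton]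
    constructor
    · intro hq
      induction q using QuotientGroup.induction_on with
      | H g =>
      have hc : ∀ y ∈ closure X, g⁻¹ * y * g ∈ H := by
        intro y hy
        have h3 := hq y (hYZ hy)
        change ((y * g : G) : G ⧸ H) = g at h3
        rw [eq_comm, QuotientGroup.eq] at h3
        rwa [← mul_assoc] at h3
      let R := (closure X).map (MulAut.conj g⁻¹).toMonoidHom
      have hRH : R ≤ H := by
        rintro _ ⟨y, hy, rfl⟩
        simpa using hc y hy
      have hRp : IsPGroup p R := (P.isPGroup'.to_le hYP).map _
      obtain ⟨n, hn, hnr⟩ := sylow_conj_le H (P.subtype hPH) R hRH hRp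
      have hgn : n⁻¹ * g⁻¹ ∈ H := by
        rw [hH]
        apply mem_norm_of_le
        apply conj_closure
        intro u hu
        apply Subgroup.subset_closure
        have h4 := hnr (g⁻¹ * u * g) ⟨u, Subgroup.subset_closure hu, by simp⟩
        obtain ⟨v, hv, hv2⟩ := h4
        have hv3 : (v : G) ∈ P := hv
        have e : (v : G) = (n⁻¹ * g⁻¹) * u * (n⁻¹ * g⁻¹)⁻¹ := by
          rw [show (v : G) = _ from hv2]; group
        rw [← e, hX]
        rw [hX] at hu
        exact ⟨hv3, hu.2.trans (isConj_iff.2 ⟨_, e.symm⟩)⟩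
      rw [eq_comm, QuotientGroup.eq]
      have := inv_mem ((mul_mem_cancel_left (inv_mem hn)).1 hgn)
      simpa using this
    · rintro rfl z hz
      change ((z * 1 : G) : G ⧸ H) = (1 : G)
      rw [eq_comm, QuotientGroup.eq]
      simpa using hPH (hYP (hZP hz))
  rw [hZs, hfil, Finset.sum_singleton, hF]
  simp
end transfer
end SNT

namespace SNT

set_option linter.unusedSectionVars false

section A
variable {G : Type*} [Group G] [Finite G] {p : ℕ} [hp : Fact p.Prime]

def StatA (p : ℕ) (G : Type*) [Group G] : Prop :=
  ∀ (P : Sylow p G) (t : G → AA p), HomOn (P : Subgroup G) t →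
    StableOn (normalizer (WW (P : Subgroup G) : Set G)) (P : Subgroup G) t →
    StableOn ⊤ (P : Subgroup G) t

lemma card_lt_of_ne_top (N : Subgroup G) (h : N ≠ ⊤) : Nat.card N < Nat.card G := by
  by_contra hc
  exact h (Subgroup.eq_top_of_le_card N (by omega))

lemma A_sub {G : Type*} [Group G] [Finite G] {p : ℕ} (N : Subgroup G) (hA : StatA p N)
    (X : Sylow p N) (t : G → AA p)
    (ht : HomOn ((X : Subgroup N).map N.subtype) t)
    (hs : StableOn (N ⊓ normalizer (WW ((X : Subgroup N).map N.subtype) : Set G))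
      ((X : Subgroup N).map N.subtype) t) :
    StableOn N ((X : Subgroup N).map N.subtype) t := by
  have h := hA X (fun u => t u) (fun u hu v hv => ht u ⟨u, hu, rfl⟩ v ⟨v, hv, rfl⟩) (by
    intro h hh u hu hv
    refine hs h ⟨h.2, ?_⟩ u ⟨u, hu, rfl⟩ ⟨_, hv, rfl⟩
    rw [WW_map _ N.subtype_injective]
    apply mem_norm_of_le
    rintro _ ⟨z, hz, rfl⟩
    exact ⟨_, (mem_normalizer_iff.1 hh z).1 hz, rfl⟩)
  intro n hn u hu hv
  obtain ⟨u, hu, rfl⟩ := hu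
  obtain ⟨v, hv, hv2⟩ := hv
  have e : (⟨n, hn⟩ : N) * u * (⟨n, hn⟩ : N)⁻¹ = v := Subtype.ext hv2.symm
  exact h ⟨n, hn⟩ trivial u hu (by rw [e]; exact hv)

lemma A_sub' {G : Type*} [Group G] [Finite G] {p : ℕ} (N : Subgroup G) (hA : StatA p N)
    (P : Sylow p G) (hPN : (P : Subgroup G) ≤ N) (t : G → AA p) (ht : HomOn (P : Subgroup G) t)
    (hs : StableOn (normalizer (WW (P : Subgroup G) : Set G)) (P : Subgroup G) t) :
    StableOn N (P : Subgroup G) t := by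
  have e : ((P.subtype hPN : Sylow p N) : Subgroup N).map N.subtype = (P : Subgroup G) := by
    rw [Sylow.coe_subtype]
    exact map_subgroupOf_eq_of_le hPN
  have := A_sub N hA (P.subtype hPN) t
  rw [e] at this
  exact this ht (hs.mono inf_le_right le_rfl)

lemma extendH (H : Subgroup G) (P : Sylow p G) (hPH : (P : Subgroup G) ≤ H) (t : G → AA p)
    (ht : HomOn (P : Subgroup G) t) (hs : StableOn H (P : Subgroup G) t) :
    ∃ s : G → AA p, HomOn H s ∧ ∀ u ∈ P, s u = t u := by
  classical
  obtain ⟨Θ, hΘ⟩ := extend (P.subtype hPH) (fun u : H => t u)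
    (fun u hu v hv => ht u hu v hv) (fun h _ u hu hv => hs h h.2 u hu hv)
  refine ⟨fun g => if h : g ∈ H then Θ ⟨g, h⟩ else 1, ?_, ?_⟩
  · intro u hu v hv
    simp only [dif_pos hu, dif_pos hv, dif_pos (mul_mem hu hv), ← map_mul]
    rfl
  · intro u hu
    simp only [dif_pos (hPH hu)]
    exact hΘ ⟨u, hPH hu⟩ hu

lemma normal_le_sylow (P : Sylow p G) (N : Subgroup G) [N.Normal] (hN : IsPGroup p N) :
    N ≤ P := by
  have h := IsPGroup.to_sup_of_normal_right P.isPGroup' hN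
  have := P.is_maximal' h le_sup_left
  rw [← this]
  exact le_sup_right

lemma exists_core (p : ℕ) [Fact p.Prime] (G : Type*) [Group G] [Finite G] :
    ∃ Q : Subgroup G, Q.Normal ∧ IsPGroup p Q ∧
    ∀ N : Subgroup G, N.Normal → IsPGroup p N → N ≤ Q := by
  obtain ⟨Q, ⟨hQ1, hQ2⟩, hmax⟩ := (Set.toFinite {Q : Subgroup G | Q.Normal ∧
    IsPGroup p Q}).exists_maximal ⟨⊥, inferInstance, IsPGroup.of_bot⟩
  refine ⟨Q, hQ1, hQ2, fun N hN hNp => ?_⟩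
  exact le_sup_right.trans (hmax (y := Q ⊔ N) ⟨inferInstance, hQ2.to_sup_of_normal_right hNp⟩
    le_sup_left)

lemma quot_stable (Q : Subgroup G) [hQ : Q.Normal] (P : Sylow p G) (hQP : Q ≤ P)
    (ψ : G → AA p) (hψ : HomOn (P : Subgroup G) ψ) (h1 : ∀ q ∈ Q, ψ q = 1)
    (hA : StatA p (G ⧸ Q))
    (hs : StableOn ((normalizer (WW ((P : Subgroup G).map (QuotientGroup.mk' Q)) :
      Set (G ⧸ Q))).comap (QuotientGroup.mk' Q)) (P : Subgroup G) ψ) :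
    StableOn ⊤ (P : Subgroup G) ψ := by
  let π := QuotientGroup.mk' Q
  have hπ : Function.Surjective π := QuotientGroup.mk'_surjective Q
  let P' : Sylow p (G ⧸ Q) := P.mapSurjective hπ
  have hP' : (P' : Subgroup (G ⧸ Q)) = (P : Subgroup G).map π := rfl
  have hmemP : ∀ g, π g ∈ P' → g ∈ P := by
    rintro g ⟨u, hu, he⟩
    have : u⁻¹ * g ∈ Q := QuotientGroup.eq.1 he
    have h' : u * (u⁻¹ * g) ∈ (P : Subgroup G) := mul_mem hu (hQP this)
    rw [mul_inv_cancel_left] at h'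
    exact h'
  have hmem' : ∀ g, g ∈ P → π g ∈ P' := fun g hg => ⟨g, hg, rfl⟩
  let ψ' : G ⧸ Q → AA p := fun q => ψ q.out
  have hψ' : ∀ u ∈ P, ψ' (π u) = ψ u := by
    intro u hu
    obtain ⟨q, hq⟩ := QuotientGroup.mk_out_eq_mul Q u
    change ψ ((u : G ⧸ Q).out) = ψ u
    rw [hq, hψ u hu q (hQP q.2), h1 q q.2, mul_one]
  have hst := hA P' ψ' (by
      rintro u hu v hv
      obtain ⟨u, rfl⟩ := hπ u
      obtain ⟨v, rfl⟩ := hπ v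
      have hu' := hmemP u hu
      have hv' := hmemP v hv
      rw [← map_mul, hψ' _ hu', hψ' _ hv', hψ' _ (mul_mem hu' hv'), hψ u hu' v hv']) (by
      rintro h hh u hu hv
      obtain ⟨u, rfl⟩ := hπ u
      obtain ⟨h, rfl⟩ := hπ h
      rw [← map_inv, ← map_mul, ← map_mul] at hv ⊢
      rw [hψ' _ (hmemP _ hv), hψ' _ (hmemP _ hu)]
      exact hs h hh u (hmemP _ hu) (hmemP _ hv))
  intro g _ u hu hv
  have := hst (π g) trivial (π u) (hmem' u hu) (by
    rw [← map_inv, ← map_mul, ← map_mul]; exact hmem' _ hv)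
  rwa [← map_inv, ← map_mul, ← map_mul, hψ' _ hu, hψ' _ hv] at this

lemma card_quot_lt (Q : Subgroup G) (hQ : Q ≠ ⊥) : Nat.card (G ⧸ Q) < Nat.card G := by
  rw [Subgroup.card_eq_card_quotient_mul_card_subgroup Q]
  have h1 : 1 < Nat.card Q := (Subgroup.one_lt_card_iff_ne_bot Q).2 hQ
  have h2 : 0 < Nat.card (G ⧸ Q) := Nat.card_pos
  nlinarith

/-- the case with a nontrivial core -/
lemma caseQ (hN : ∀ N : Subgroup G, N ≠ ⊤ → StatA p N) (Q : Subgroup G) [hQn : Q.Normal]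
    (hQp : IsPGroup p Q) (hcore : ∀ N : Subgroup G, N.Normal → IsPGroup p N → N ≤ Q)
    (hA : StatA p (G ⧸ Q)) (P : Sylow p G) (t : G → AA p) (ht : HomOn (P : Subgroup G) t)
    (hs : StableOn (normalizer (WW (P : Subgroup G) : Set G)) (P : Subgroup G) t)
    (x : G) (hxP : x ∈ P) (hxQ : x ∉ Q) (hch : Chain p x Q) :
    StableOn ⊤ (P : Subgroup G) t := by
  have hQP : Q ≤ P := normal_le_sylow P Q hQp
  have hsub : ∀ H : Subgroup G, H ≠ ⊤ → (P : Subgroup G) ≤ H → StableOn H (P : Subgroup G) t :=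
    fun H hH hPH => A_sub' H (hN H hH) P hPH t ht hs
  let X : Set G := {u | u ∈ P ∧ IsConj x u}
  let H := normalizer (closure X : Set G)
  have hXP : closure X ≤ P := (closure_le _).2 fun u hu => hu.1
  have hPH : (P : Subgroup G) ≤ H := by
    intro g hg
    refine mem_norm_of_le _ g (conj_closure X _ g fun u hu => Subgroup.subset_closure ?_)
    exact ⟨mul_mem (mul_mem hg hu.1) (inv_mem hg), hu.2.trans (isConj_iff.2 ⟨g, rfl⟩)⟩
  have hHtop : H ≠ ⊤ := by
    intro h
    have hn : (closure X).Normal := normalizer_eq_top_iff.1 h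
    apply hxQ
    exact hcore _ hn (P.isPGroup'.to_le hXP) (Subgroup.subset_closure ⟨hxP, IsConj.refl x⟩)
  obtain ⟨s, hsH, hst⟩ := extendH H P hPH t ht (hsub H hHtop hPH)
  have hchain : ∀ D : Subgroup G, Chain p x D → D ≤ P → ∃ Θ : G →* AA p, ∀ d ∈ D, Θ d = t d := by
    intro D hD
    induction hD with
    | bot =>
      intro _
      refine ⟨1, fun d hd => ?_⟩
      rw [mem_bot] at hd
      rw [hd, map_one, ht.one]
    | step D D' hDn hD' hle hstep ih =>
      intro hDP
      obtain ⟨Θ', hΘ'⟩ := ih (hle.trans hDP)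
      have hDn' := hD'.normal
      obtain ⟨V, hV⟩ := trans_step P x X rfl H rfl D D' hDP hle hstep
        (fun g => s g * (Θ' g)⁻¹) (by
          intro u hu v hv
          simp only [hsH u hu v hv, map_mul, mul_inv]
          exact mul_mul_mul_comm _ _ _ _) (by
          intro y hy
          simp only [hst y (hDP (hle hy)), hΘ' y hy, mul_inv_cancel])
      refine ⟨V * Θ', fun d hd => ?_⟩
      rw [MonoidHom.mul_apply, hV d hd, inv_mul_cancel_right, hst d (hDP hd)]
  obtain ⟨Θ, hΘ⟩ := hchain Q hch hQP
  let ψ : G → AA p := fun g => t g * (Θ g)⁻¹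
  have hΘc : ∀ g u : G, Θ (g * u * g⁻¹) = Θ u := by
    intro g u
    rw [map_mul, map_mul, map_inv, mul_comm (Θ g), mul_inv_cancel_right]
  have hψ : HomOn (P : Subgroup G) ψ := by
    intro u hu v hv
    simp only [ψ, ht u hu v hv, map_mul, mul_inv]
    exact mul_mul_mul_comm _ _ _ _
  let N1 := (normalizer (WW ((P : Subgroup G).map (QuotientGroup.mk' Q)) :
      Set (G ⧸ Q))).comap (QuotientGroup.mk' Q)
  have hPp : IsPGroup p ((P : Subgroup G).map (QuotientGroup.mk' Q)) := P.isPGroup'.map _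
  have hN1 : N1 ≠ ⊤ := by
    intro h
    have hn : (WW ((P : Subgroup G).map (QuotientGroup.mk' Q))).Normal := by
      rw [← normalizer_eq_top_iff]
      rw [eq_top_iff]
      intro q _
      obtain ⟨g, rfl⟩ := QuotientGroup.mk'_surjective Q q
      have : g ∈ N1 := by rw [h]; trivial
      exact this
    have h2 := hcore ((WW ((P : Subgroup G).map (QuotientGroup.mk' Q))).comap
      (QuotientGroup.mk' Q)) inferInstance
      ((hPp.to_le (WW_le _)).comap_of_ker_isPGroup _ (by rwa [QuotientGroup.ker_mk']))
    have h3 : (P : Subgroup G).map (QuotientGroup.mk' Q) = ⊥ := by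
      by_contra hne
      apply WW_ne_bot _ hPp hne
      rw [eq_bot_iff]
      intro q hq
      obtain ⟨g, rfl⟩ := QuotientGroup.mk'_surjective Q q
      have := h2 hq
      rw [mem_bot]
      exact (QuotientGroup.eq_one_iff g).2 this
    apply hxQ
    have : QuotientGroup.mk' Q x ∈ (P : Subgroup G).map (QuotientGroup.mk' Q) := ⟨x, hxP, rfl⟩
    rw [h3, mem_bot] at this
    exact (QuotientGroup.eq_one_iff x).1 this
  have hPN1 : (P : Subgroup G) ≤ N1 := by
    intro g hg
    have : QuotientGroup.mk' Q g ∈ (P : Subgroup G).map (QuotientGroup.mk' Q) := ⟨g, hg, rfl⟩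
    have h4 : (P : Subgroup G).map (QuotientGroup.mk' Q) ≤ normalizer
        (WW ((P : Subgroup G).map (QuotientGroup.mk' Q)) : Set (G ⧸ Q)) := by
      intro c hc
      rw [mem_normalizer_iff_map_conj_eq]
      have h5 := WW_conj ((P : Subgroup G).map (QuotientGroup.mk' Q)) c
      have h6 := mem_normalizer_iff_map_conj_eq.1 (le_normalizer hc)
      exact h5.symm.trans (by rw [show map (MulAut.conj c).toMonoidHom
        ((P : Subgroup G).map (QuotientGroup.mk' Q)) = _ from h6])
    exact h4 this
  have hst2 := quot_stable Q P hQP ψ hψ (fun q hq => by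
      simp only [ψ, hΘ q hq, mul_inv_cancel]) hA (by
      intro g hg u hu hv
      simp only [ψ, hΘc]
      rw [hsub N1 hN1 hPN1 g hg u hu hv])
  intro g hg u hu hv
  have := hst2 g hg u hu hv
  simp only [ψ, hΘc] at this
  exact mul_right_cancel this

end A
end SNT

namespace SNT

section B
variable {G : Type*} [Group G] [Finite G] {p : ℕ} [hp : Fact p.Prime]

lemma norm_le_norm_WW (X : Subgroup G) :
    normalizer (X : Set G) ≤ normalizer (WW X : Set G) := by
  intro c hc
  rw [mem_normalizer_iff_map_conj_eq]
  have h5 := WW_conj X c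
  have h6 := mem_normalizer_iff_map_conj_eq.1 hc
  exact h5.symm.trans (by rw [show map (MulAut.conj c).toMonoidHom X = _ from h6])

structure TT (T : Sylow p G → G → AA p) : Prop where
  hom : ∀ S : Sylow p G, HomOn (S : Subgroup G) (T S)
  conj : ∀ (S : Sylow p G) (g u : G), u ∈ S → T (g • S) (g * u * g⁻¹) = T S u
  stable : ∀ S : Sylow p G,
    StableOn (normalizer (WW (S : Subgroup G) : Set G)) (S : Subgroup G) (T S)

lemma exists_TT (P : Sylow p G) (t : G → AA p) (ht : HomOn (P : Subgroup G) t)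
    (hs : StableOn (normalizer (WW (P : Subgroup G) : Set G)) (P : Subgroup G) t) :
    ∃ T : Sylow p G → G → AA p, TT T ∧ ∀ u ∈ P, T P u = t u := by
  choose c hc using fun S : Sylow p G => MulAction.exists_smul_eq G P S
  let T : Sylow p G → G → AA p := fun S u => t ((c S)⁻¹ * u * c S)
  have hm : ∀ (S : Sylow p G) (u : G), u ∈ S → (c S)⁻¹ * u * c S ∈ P := by
    intro S u hu
    rw [← mem_smul_sylow, hc]
    exact hu
  have T_eq : ∀ (S : Sylow p G) (g u : G), g • P = S → u ∈ S → T S u = t (g⁻¹ * u * g) := by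
    intro S g u hg hu
    have h1 := hm S u hu
    have h2 : g⁻¹ * u * g ∈ P := by
      rw [← mem_smul_sylow, hg]; exact hu
    have h3 : g⁻¹ * c S ∈ normalizer ((P : Subgroup G) : Set G) := by
      refine Sylow.smul_eq_iff_mem_normalizer.1 ?_
      rw [mul_smul, hc, ← hg, inv_smul_smul]
    have e : (g⁻¹ * c S) * ((c S)⁻¹ * u * c S) * (g⁻¹ * c S)⁻¹ = g⁻¹ * u * g := by group
    have := hs _ (norm_le_norm_WW _ h3) _ h1 (by rw [e]; exact h2)
    rw [e] at this
    exact this.symm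
  refine ⟨T, ⟨?_, ?_, ?_⟩, ?_⟩
  · intro S u hu v hv
    have := ht _ (hm S u hu) _ (hm S v hv)
    change t _ = t _ * t _
    rw [← this]
    congr 1
    group
  · intro S g u hu
    rw [T_eq (g • S) (g * c S) _ (by rw [mul_smul, hc])]
    · change _ = t _
      congr 1
      group
    · rw [mem_smul_sylow]
      have e : g⁻¹ * (g * u * g⁻¹) * g = u := by group
      rw [e]; exact hu
  · intro S h hh u hu hv
    have hSm : (S : Subgroup G) = (P : Subgroup G).map (MulAut.conj (c S)).toMonoidHom := by
      ext y
      constructor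
      · intro hy
        exact ⟨_, hm S y hy, by simp [mul_assoc]⟩
      · rintro ⟨z, hz, rfl⟩
        change c S * z * (c S)⁻¹ ∈ S
        rw [← hc S, mem_smul_sylow, hc S]
        have e : (c S)⁻¹ * (c S * z * (c S)⁻¹) * c S = z := by group
        rw [e]; exact hz
    have hW : WW (S : Subgroup G) =
        (WW (P : Subgroup G)).map (MulAut.conj (c S)).toMonoidHom := by
      conv_lhs => rw [hSm]
      exact WW_conj _ _
    have h1 : (c S)⁻¹ * h * c S ∈ normalizer (WW (P : Subgroup G) : Set G) := by
      apply mem_norm_of_le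
      intro z hz
      have h2 : c S * z * (c S)⁻¹ ∈ WW (S : Subgroup G) := by
        rw [hW]; exact ⟨z, hz, rfl⟩
      have h3 := (mem_normalizer_iff.1 hh _).1 h2
      rw [hW] at h3
      obtain ⟨w, hw, he⟩ := h3
      have he' : c S * w * (c S)⁻¹ = h * (c S * z * (c S)⁻¹) * h⁻¹ := he
      have e : (c S)⁻¹ * h * c S * z * ((c S)⁻¹ * h * c S)⁻¹ =
        (c S)⁻¹ * (h * (c S * z * (c S)⁻¹) * h⁻¹) * c S := by group
      rw [e, ← he']
      have e : (c S)⁻¹ * (c S * w * (c S)⁻¹) * c S = w := by group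
      rw [e]; exact hw
    have e : ((c S)⁻¹ * h * c S) * ((c S)⁻¹ * u * c S) * ((c S)⁻¹ * h * c S)⁻¹ =
      (c S)⁻¹ * (h * u * h⁻¹) * c S := by group
    have := hs _ h1 _ (hm S u hu) (by rw [e]; exact hm S _ hv)
    rw [e] at this
    exact this
  · intro u hu
    rw [T_eq P 1 u (one_smul _ _) hu]
    simp

lemma exists_sub_sylow (N Y : Subgroup G) (hY : Y ≤ N) (hYp : IsPGroup p Y) :
    ∃ X : Sylow p N, Y ≤ (X : Subgroup N).map N.subtype := by
  have h1 : IsPGroup p (Y.subgroupOf N) := hYp.comap_of_injective N.subtype N.subtype_injective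
  obtain ⟨Q, hQ⟩ := h1.exists_le_sylow
  exact ⟨Q, fun y hy => ⟨⟨y, hY hy⟩, hQ hy, rfl⟩⟩

def Agree (T : Sylow p G → G → AA p) (n : ℕ) : Prop :=
  ∀ S S' : Sylow p G, n < Nat.card ((S : Subgroup G) ⊓ S' : Subgroup G) →
    ∀ u, u ∈ S → u ∈ S' → T S u = T S' u

lemma Agree.le {T : Sylow p G → G → AA p} {n : ℕ} (h : Agree T n) (X : Subgroup G)
    (hX : n < Nat.card X) (S S' : Sylow p G) (h1 : X ≤ S) (h2 : X ≤ S') :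
    ∀ u ∈ X, T S u = T S' u := fun u hu =>
  h S S' (hX.trans_le (Subgroup.card_le_of_le (le_inf h1 h2))) u (h1 hu) (h2 hu)

lemma card_lt_of_lt {X Y : Subgroup G} (h : X < Y) : Nat.card X < Nat.card Y := by
  by_contra hc
  exact h.ne (Subgroup.eq_of_le_of_card_ge h.le (not_lt.1 hc))

lemma claim3 (hN : ∀ N : Subgroup G, N ≠ ⊤ → StatA p N)
    (hcore : ∀ N : Subgroup G, N.Normal → IsPGroup p N → N = ⊥)
    (T : Sylow p G → G → AA p) (hT : TT T) (n : ℕ) (hn : Agree T n) (k : ℕ) :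
    ∀ (X : Subgroup G) (S : Sylow p G), X ≤ S → n < Nat.card X → Nat.card G < Nat.card X + k →
      StableOn (normalizer (WW X : Set G)) X (T S) := by
  induction k with
  | zero =>
    intro X S _ _ h
    have := Subgroup.card_le_card_group X
    omega
  | succ k ih =>
    intro X S hXS hnX hk
    have hXp : IsPGroup p X := S.isPGroup'.to_le hXS
    by_cases hb : X = ⊥
    · intro h _ u hu hv
      rw [hb, mem_bot] at hu
      rw [hu, mul_one, mul_inv_cancel]
    rcases hXS.eq_or_lt with rfl | hlt
    · exact hT.stable S
    have htop : normalizer (WW X : Set G) ≠ ⊤ := fun h =>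
      WW_ne_bot X hXp hb (hcore _ (normalizer_eq_top_iff.1 h) (hXp.to_le (WW_le X)))
    obtain ⟨g, hgS, hgX, hgn⟩ := exists_norm (S : Subgroup G) X S.isPGroup' hlt
    obtain ⟨X2, hX2⟩ := exists_sub_sylow (p := p) (normalizer (WW X : Set G))
      ((S : Subgroup G) ⊓ normalizer (X : Set G))
      (inf_le_right.trans (norm_le_norm_WW X)) (S.isPGroup'.to_le inf_le_left)
    have hX2p : IsPGroup p ((X2 : Subgroup _).map (normalizer (WW X : Set G)).subtype) :=
      X2.isPGroup'.map _
    obtain ⟨S2, hS2⟩ := hX2p.exists_le_sylow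
    have hXX2 : X < (X2 : Subgroup _).map (normalizer (WW X : Set G)).subtype := by
      refine lt_of_le_of_ne ((le_inf hXS le_normalizer).trans hX2) fun he => hgX ?_
      rw [he]
      exact hX2 ⟨hgS, hgn⟩
    have hc := card_lt_of_lt hXX2
    have h1 := ih _ S2 hS2 (hnX.trans hc) (by omega)
    have h2 := A_sub _ (hN _ htop) X2 (T S2) ((hT.hom S2).mono hS2) (h1.mono inf_le_right le_rfl)
    exact (h2.mono le_rfl hXX2.le).congr (hn.le X hnX S2 S (hXX2.le.trans hS2) hXS)

lemma agree_all (hN : ∀ N : Subgroup G, N ≠ ⊤ → StatA p N)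
    (hcore : ∀ N : Subgroup G, N.Normal → IsPGroup p N → N = ⊥)
    (T : Sylow p G → G → AA p) (hT : TT T) (k : ℕ) :
    ∀ S S' : Sylow p G, Nat.card G < Nat.card ((S : Subgroup G) ⊓ S' : Subgroup G) + k →
      ∀ u, u ∈ S → u ∈ S' → T S u = T S' u := by
  induction k with
  | zero =>
    intro S S' h
    have := Subgroup.card_le_card_group ((S : Subgroup G) ⊓ S')
    omega
  | succ k ih =>
    intro S S' hk u hu hu'
    by_cases hSS : S = S'
    · rw [hSS]
    set R := (S : Subgroup G) ⊓ S' with hR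
    have hRp : IsPGroup p R := S.isPGroup'.to_le inf_le_left
    have hag : Agree T (Nat.card R) := fun A B hAB => ih A B (by omega)
    by_cases hb : R = ⊥
    · have : u ∈ R := ⟨hu, hu'⟩
      rw [hb, mem_bot] at this
      rw [this, (hT.hom S).one, (hT.hom S').one]
    have htop : normalizer (R : Set G) ≠ ⊤ := fun h =>
      hb (hcore _ (normalizer_eq_top_iff.1 h) hRp)
    have hlt : R < S := by
      refine lt_of_le_of_ne inf_le_left fun he => hSS ?_
      have : (S : Subgroup G) ≤ S' := by rw [← he]; exact inf_le_right
      exact Sylow.ext (S.is_maximal' S'.isPGroup' this).symm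
    have hlt' : R < S' := by
      refine lt_of_le_of_ne inf_le_right fun he => hSS ?_
      have : (S' : Subgroup G) ≤ S := by rw [← he]; exact inf_le_left
      exact Sylow.ext (S'.is_maximal' S.isPGroup' this)
    have main : ∀ A : Sylow p G, R < A → ∃ (X : Sylow p (normalizer (R : Set G))) (A1 : Sylow p G),
        R < (X : Subgroup _).map (normalizer (R : Set G)).subtype ∧
        (X : Subgroup _).map (normalizer (R : Set G)).subtype ≤ A1 ∧
        ∀ r ∈ R, T A r = T A1 r := by
      intro A hA
      obtain ⟨g, hgS, hgX, hgn⟩ := exists_norm (A : Subgroup G) R A.isPGroup' hA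
      obtain ⟨X, hX⟩ := exists_sub_sylow (p := p) (normalizer (R : Set G))
        ((A : Subgroup G) ⊓ normalizer (R : Set G)) inf_le_right (A.isPGroup'.to_le inf_le_left)
      have hXp : IsPGroup p ((X : Subgroup _).map (normalizer (R : Set G)).subtype) :=
        X.isPGroup'.map _
      obtain ⟨A1, hA1⟩ := hXp.exists_le_sylow
      have hRX : R < (X : Subgroup _).map (normalizer (R : Set G)).subtype := by
        refine lt_of_le_of_ne ((le_inf hA.le le_normalizer).trans hX) fun he => hgX ?_
        rw [he]
        exact hX ⟨hgS, hgn⟩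
      refine ⟨X, A1, hRX, hA1, ?_⟩
      have hlt2 : R < (A : Subgroup G) ⊓ normalizer (R : Set G) :=
        lt_of_le_of_ne (le_inf hA.le le_normalizer) fun he => hgX (by rw [he]; exact ⟨hgS, hgn⟩)
      have := hag.le _ (card_lt_of_lt hlt2) A A1 inf_le_left (hX.trans hA1)
      exact fun r hr => this r (hlt2.le hr)
    obtain ⟨X, S1, hX1, hX2, hX3⟩ := main S hlt
    obtain ⟨X', S1', hX1', hX2', hX3'⟩ := main S' hlt'
    rw [hX3 u ⟨hu, hu'⟩, hX3' u ⟨hu, hu'⟩]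
    obtain ⟨m, hm⟩ := MulAction.exists_smul_eq (normalizer (R : Set G)) X X'
    have huR : u ∈ R := ⟨hu, hu'⟩
    -- stability of `T S1` on `X`
    have h1 := claim3 hN hcore T hT _ hag (Nat.card G + 1) _ S1 hX2 (card_lt_of_lt hX1) (by omega)
    have h2 := A_sub _ (hN _ htop) X (T S1) ((hT.hom S1).mono hX2) (h1.mono inf_le_right le_rfl)
    have hle : (X' : Subgroup _).map (normalizer (R : Set G)).subtype ≤
        ((m : G) • S1 : Sylow p G) := by
      rintro _ ⟨x, hx, rfl⟩
      have hx' : x ∈ m • X := by rw [hm]; exact hx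
      rw [mem_smul_sylow] at hx'
      exact (mem_smul_sylow S1 (m : G) x).2 (hX2 ⟨_, hx', rfl⟩)
    have h3 := hag.le _ (card_lt_of_lt hX1') _ _ hle hX2' u (hX1'.le huR)
    rw [← h3]
    have hmn := inv_mem m.2
    have hv : (m : G)⁻¹ * u * m ∈ R := by
      have := (mem_normalizer_iff.1 hmn u).1 huR
      simpa using this
    have h4 := hT.conj S1 (m : G) ((m : G)⁻¹ * u * m) (hX2 (hX1.le hv))
    have e : (m : G) * ((m : G)⁻¹ * u * m) * (m : G)⁻¹ = u := by group
    rw [e] at h4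
    rw [h4]
    have h5 := h2 m m.2 _ (hX1.le hv) (by rw [e]; exact hX1.le huR)
    rwa [e] at h5

lemma case1 (hN : ∀ N : Subgroup G, N ≠ ⊤ → StatA p N)
    (hcore : ∀ N : Subgroup G, N.Normal → IsPGroup p N → N = ⊥) : StatA p G := by
  intro P t ht hs
  obtain ⟨T, hT, hTP⟩ := exists_TT P t ht hs
  intro g _ u hu hv
  have hm : g * u * g⁻¹ ∈ g • P := by
    rw [mem_smul_sylow]
    have e : g⁻¹ * (g * u * g⁻¹) * g = u := by group
    rw [e]; exact hu
  rw [← hTP _ hv, ← hTP _ hu, ← hT.conj P g u hu]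
  exact agree_all hN hcore T hT (Nat.card G + 1) P (g • P) (by omega) _ hv hm

end B

universe u

theorem theoremA (p : ℕ) [Fact p.Prime] (hp5 : 5 ≤ p) (n : ℕ) :
    ∀ (G : Type u) [Group G] [Finite G], Nat.card G = n → StatA p G := by
  induction n using Nat.strong_induction_on with
  | _ n ih =>
  intro G _ _ hn
  have hN : ∀ N : Subgroup G, N ≠ ⊤ → StatA p N := fun N h =>
    ih _ (hn ▸ card_lt_of_ne_top N h) N rfl
  obtain ⟨Q, hQn, hQp, hcore⟩ := exists_core p G
  by_cases hQ : Q = ⊥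
  · exact case1 hN fun N h1 h2 => by
      have := hcore N h1 h2
      rwa [hQ, le_bot_iff] at this
  intro P t ht hs
  by_cases hx : ∀ x ∈ (P : Subgroup G), Chain p x Q → x ∈ Q
  · have := comparison hp5 (P : Subgroup G) Q hQp (normal_le_sylow P Q hQp) hx
    have h2 : (WW (P : Subgroup G)).Normal := by rw [this]; exact WW_normal Q
    rwa [normalizer_eq_top_iff.2 h2] at hs
  · push Not at hx
    obtain ⟨x, hxP, hch, hxQ⟩ := hx
    exact caseQ hN Q hQp hcore (ih _ (hn ▸ card_quot_lt Q hQ) (G ⧸ Q) rfl) P t ht hs x hxP hxQ hch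

theorem final (p : ℕ) [hp : Fact p.Prime] (hp5 : 5 ≤ p) (n : ℕ) :
    ∀ (G : Type u) [Group G] [Finite G], Nat.card G = n → ∀ P : Sylow p G,
      (P : Subgroup G) ≠ ⊥ → normalizer ((P : Subgroup G) : Set G) = P →
      ∃ t : G → AA p, HomOn (P : Subgroup G) t ∧ StableOn ⊤ (P : Subgroup G) t ∧
        ∃ u ∈ P, t u ≠ 1 := by
  classical
  induction n using Nat.strong_induction_on with
  | _ n ih =>
  intro G _ _ hn P hP hself
  by_cases hW : normalizer (WW (P : Subgroup G) : Set G) = ⊤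
  · have hWn : (WW (P : Subgroup G)).Normal := normalizer_eq_top_iff.1 hW
    have hWne := WW_ne_bot (P : Subgroup G) P.isPGroup' hP
    rcases (WW_le (P : Subgroup G)).eq_or_lt with he | hlt
    · -- `P` is normal, so `G` is a `p`-group
      have hPn : (P : Subgroup G).Normal := by rw [← he]; exact hWn
      have hPtop : (P : Subgroup G) = ⊤ := by rw [← hself]; exact normalizer_eq_top_iff.2 hPn
      have hG : IsPGroup p G := by
        have := P.isPGroup'
        intro g
        obtain ⟨k, hk⟩ := this ⟨g, by
          change g ∈ (P : Subgroup G); rw [hPtop]; trivial⟩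
        exact ⟨k, congrArg Subtype.val hk⟩
      obtain ⟨k, hk⟩ := IsPGroup.iff_card.1 hG
      have hk0 : k ≠ 0 := by
        rintro rfl
        rw [pow_zero] at hk
        apply hP
        rw [hPtop]
        have : Subsingleton G := (Nat.card_eq_one_iff_unique.1 hk).1
        exact Subsingleton.elim _ _
      obtain ⟨j, rfl⟩ := Nat.exists_eq_succ_of_ne_zero hk0
      obtain ⟨K, hK⟩ := Sylow.exists_subgroup_card_pow_prime p (G := G) (n := j)
        (by rw [hk]; exact pow_dvd_pow _ (Nat.le_succ j))
      have hidx : K.index = p := by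
        have := K.card_mul_index
        rw [hK, hk, pow_succ] at this
        exact Nat.eq_of_mul_eq_mul_left (pow_pos hp.out.pos _) this
      have hKn : K.Normal := by
        apply Subgroup.normal_of_index_eq_minFac_card
        rw [hidx, hk, Nat.Prime.pow_minFac hp.out hk0]
      have hq : Nat.card (G ⧸ K) = p := hidx
      have ha : Nat.card (AA p) = p := by
        rw [Nat.card_congr Multiplicative.toAdd, Nat.card_zmod]
      let f : G ⧸ K ≃* AA p := mulEquivOfPrimeCardEq hq ha
      refine ⟨fun g => f (QuotientGroup.mk' K g), fun u _ v _ => by simp only [map_mul], ?_, ?_⟩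
      · intro h _ u _ _
        simp only [map_mul, map_inv]
        rw [mul_comm (f _) (f _), mul_inv_cancel_right]
      · by_contra hcon
        push Not at hcon
        have : K = ⊤ := by
          rw [eq_top_iff]
          intro g _
          have h1 := hcon g (by change g ∈ (P : Subgroup G); rw [hPtop]; trivial)
          rw [EmbeddingLike.map_eq_one_iff] at h1
          exact (QuotientGroup.eq_one_iff g).1 h1
        rw [this, index_top] at hidx
        exact hp.out.one_lt.ne hidx
    · set W := WW (P : Subgroup G) with hWdef
      have hπ : Function.Surjective (QuotientGroup.mk' W) := QuotientGroup.mk'_surjective W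
      have hmemP : ∀ g, QuotientGroup.mk' W g ∈ P.mapSurjective hπ → g ∈ P := by
        rintro g ⟨u, hu, he⟩
        have : u⁻¹ * g ∈ W := QuotientGroup.eq.1 he
        have h' : u * (u⁻¹ * g) ∈ (P : Subgroup G) := mul_mem hu (hlt.le this)
        rw [mul_inv_cancel_left] at h'
        exact h'
      have hmem' : ∀ g, g ∈ P → QuotientGroup.mk' W g ∈ P.mapSurjective hπ :=
        fun g hg => ⟨g, hg, rfl⟩
      obtain ⟨t, ht, hst, q, hq, htq⟩ := ih _ (hn ▸ card_quot_lt W hWne) (G ⧸ W) rfl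
        (P.mapSurjective hπ) (by
          intro h
          apply hlt.not_ge
          intro g hg
          have h1 : QuotientGroup.mk' W g ∈ (P.mapSurjective hπ : Subgroup (G ⧸ W)) := hmem' g hg
          rw [h, mem_bot] at h1
          exact (QuotientGroup.eq_one_iff g).1 h1) (by
          apply le_antisymm _ le_normalizer
          intro q hq
          obtain ⟨g, rfl⟩ := hπ q
          apply hmem'
          change g ∈ (P : Subgroup G)
          rw [← hself]
          apply mem_norm_of_le
          intro z hz
          apply hmemP
          rw [map_mul, map_mul, map_inv]
          exact (mem_normalizer_iff.1 hq _).1 (hmem' z hz))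
      refine ⟨fun g => t (QuotientGroup.mk' W g), ?_, ?_, ?_⟩
      · intro u hu v hv
        simp only [map_mul]
        exact ht _ (hmem' u hu) _ (hmem' v hv)
      · intro h _ u hu hv
        have := hmem' _ hv
        simp only [map_mul, map_inv] at this ⊢
        exact hst _ trivial _ (hmem' u hu) this
      · obtain ⟨g, rfl⟩ := hπ q
        exact ⟨g, hmemP g hq, htq⟩
  · set N := normalizer (WW (P : Subgroup G) : Set G) with hNdef
    have hPN : (P : Subgroup G) ≤ N := le_normalizer.trans (norm_le_norm_WW _)
    obtain ⟨t, ht, hst, q, hq, htq⟩ := ih _ (hn ▸ card_lt_of_ne_top N hW) N rfl (P.subtype hPN) (by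
        intro h
        apply hP
        rw [eq_bot_iff]
        intro g hg
        have h1 : (⟨g, hPN hg⟩ : N) ∈ (P.subtype hPN : Subgroup N) := hg
        rw [h, mem_bot] at h1
        exact congrArg Subtype.val h1) (by
        apply le_antisymm _ le_normalizer
        intro g hg
        change (g : G) ∈ (P : Subgroup G)
        rw [← hself]
        apply mem_norm_of_le
        intro z hz
        exact (mem_normalizer_iff.1 hg ⟨z, hPN hz⟩).1 hz)
    let s : G → AA p := fun g => if h : g ∈ N then t ⟨g, h⟩ else 1
    have hs : ∀ g (h : g ∈ N), s g = t ⟨g, h⟩ := fun g h => dif_pos h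
    have hsH : HomOn (P : Subgroup G) s := by
      intro u hu v hv
      rw [hs u (hPN hu), hs v (hPN hv), hs _ (mul_mem (hPN hu) (hPN hv))]
      exact ht ⟨u, hPN hu⟩ hu ⟨v, hPN hv⟩ hv
    refine ⟨s, hsH, ?_, q, hq, ?_⟩
    · refine theoremA p hp5 _ G rfl P s hsH ?_
      intro h hh u hu hv
      rw [hs _ (hPN hu), hs _ (hPN hv)]
      exact hst ⟨h, hh⟩ trivial ⟨u, hPN hu⟩ hu hv
    · rw [hs _ q.2]
      exact htq

end SNT

/-- If `p ≥ 5` is a prime and `G` is a finite nonabelian simple group, then no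
nontrivial Sylow `p`-subgroup of `G` is self-normalizing: if `P ≠ 1` then
`P < N_G(P)`. -/
theorem sylow_lt_normalizer_of_simple {G : Type*} [Group G] [Finite G]
    [IsSimpleGroup G] (hna : ¬ ∀ a b : G, a * b = b * a)
    (p : ℕ) (hp : p.Prime) (hp5 : 5 ≤ p) (P : Sylow p G) (hP : (P : Subgroup G) ≠ ⊥) :
    (P : Subgroup G) < Subgroup.normalizer ((P : Subgroup G) : Set G) := by
  have hpf : Fact p.Prime := ⟨hp⟩
  refine lt_of_le_of_ne le_normalizer fun he => hna ?_
  obtain ⟨t, ht, hs, u, hu, htu⟩ := SNT.final p hp5 _ G rfl P hP he.symm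
  obtain ⟨Θ, hΘ⟩ := SNT.extend P t ht hs
  have hinj : Function.Injective Θ := by
    rcases (inferInstance : Θ.ker.Normal).eq_bot_or_eq_top with h | h
    · exact (MonoidHom.ker_eq_bot_iff Θ).1 h
    · exfalso
      apply htu
      rw [← hΘ u hu]
      have : u ∈ Θ.ker := by rw [h]; trivial
      exact this
  intro a b
  apply hinj
  rw [map_mul, map_mul, mul_comm]
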